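/- There is a sentence φ in the first-order language with a single binary relation symbol ∈ such that φ is a logical consequence of ZC + GC (every model of ZC + GC satisfies φ) but φ is not a logical consequence of ZC (some model of ZC satisfies ¬φ). Hence Global Choice is not conservative over ZC. -/

import Mathlib

/-!
Statement 0: Global Choice is not conservative over ZC.

There is a sentence φ in the first-order language with a single binary relation
symbol ∈ such that every model of ZC + GC satisfies φ, but some model of ZC
satisfies ¬φ (i.e. φ is not a logical consequence of ZC).
-/

open FirstOrder FirstOrder.Language

/-- The relation symbols for the language `{∈}`: a single binary relation. -/
inductive memRel : ℕ → Type
  | mem : memRel 2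

/-- The first-order language with a single binary relation symbol `∈`. -/
def Lmem : FirstOrder.Language := ⟨fun _ => Empty, memRel⟩

/-- The function symbols of the language `{∈, j}`: a single unary function symbol `j`. -/
inductive jFun : ℕ → Type
  | j : jFun 1

/-- The first-order language `{∈, j}` with a binary relation `∈` and a unary function `j`. -/
def Lmemj : FirstOrder.Language := ⟨jFun, memRel⟩

/-- A binary relation on `M` interprets the language `{∈}`. -/
def memStructure {M : Type*} (mem : M → M → Prop) : Lmem.Structure M where
  funMap := fun f _ => f.elim
  RelMap | .mem => fun x => mem (x 0) (x 1)

/-- A binary relation and a unary function on `M` interpret the language `{∈, j}`. -/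
def memjStructure {M : Type*} (mem : M → M → Prop) (j : M → M) : Lmemj.Structure M where
  funMap | .j => fun x => j (x 0)
  RelMap | .mem => fun x => mem (x 0) (x 1)

section Axioms

variable (M : Type*) (mem : M → M → Prop)

/-- Extensionality. -/
def AxExt : Prop := ∀ x y : M, (∀ z, mem z x ↔ mem z y) → x = y

/-- Pairing. -/
def AxPairing : Prop := ∀ a b : M, ∃ p : M, ∀ z, mem z p ↔ (z = a ∨ z = b)

/-- Union. -/
def AxUnion : Prop := ∀ x : M, ∃ u : M, ∀ z, mem z u ↔ ∃ w, mem z w ∧ mem w x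

/-- Power Set. -/
def AxPower : Prop := ∀ x : M, ∃ P : M, ∀ z, mem z P ↔ ∀ w, mem w z → mem w x

/-- Infinity: there is a set containing an empty set and closed under successor
`x ↦ x ∪ {x}`. -/
def AxInfinity : Prop :=
  ∃ I : M, (∃ e, mem e I ∧ ∀ z, ¬ mem z e) ∧
    ∀ x, mem x I → ∃ s, mem s I ∧ ∀ z, mem z s ↔ (mem z x ∨ z = x)

/-- The Axiom of Choice (Zermelo's form): every set of nonempty pairwise disjoint
sets admits a transversal. -/
def AxChoice : Prop :=
  ∀ F : M, (∀ a, mem a F → ∃ b, mem b a) →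
    (∀ a b, mem a F → mem b F → (∃ z, mem z a ∧ mem z b) → a = b) →
    ∃ c : M, ∀ a, mem a F → ∃! z, mem z a ∧ mem z c

/-- The Comprehension schema for the language `{∈}`: for every first-order formula
`φ(z, p̄)` of `{∈}`, every set `x` and parameters `p̄`, the set `{z ∈ x : φ(z, p̄)}` exists. -/
def AxComp : Prop :=
  ∀ (n : ℕ) (φ : Lmem.Formula (Fin (n + 1))) (x : M) (p : Fin n → M),
    ∃ s : M, ∀ z, mem z s ↔
      (mem z x ∧ (letI := memStructure mem; φ.Realize (Fin.cons z p)))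

/-- The theory ZC: Extensionality, Pairing, Union, Power Set, Infinity,
the Comprehension schema for `{∈}`-formulas, and Choice. -/
def ZC : Prop :=
  AxExt M mem ∧ AxPairing M mem ∧ AxUnion M mem ∧ AxPower M mem ∧
    AxInfinity M mem ∧ AxComp M mem ∧ AxChoice M mem

variable (j : M → M)

/-- Global Choice: `j` picks an element of every nonempty set. -/
def AxGC : Prop := ∀ x : M, (∃ y, mem y x) → mem (j x) x

/-- The Comprehension schema extended to all formulas of the language `{∈, j}`. -/
def AxCompJ : Prop :=
  ∀ (n : ℕ) (φ : Lmemj.Formula (Fin (n + 1))) (x : M) (p : Fin n → M),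
    ∃ s : M, ∀ z, mem z s ↔
      (mem z x ∧ (letI := memjStructure mem j; φ.Realize (Fin.cons z p)))

end Axioms

/-- Formulas with variables named by natural numbers and binary atoms numbered by `ℕ`. -/
inductive Fm
  | rel (r i j : ℕ)
  | bot
  | imp (φ ψ : Fm)
  | all (i : ℕ) (φ : Fm)

namespace Fm

/-- An injective numbering of formulas. -/
def code : Fm → ℕ
  | rel r i j => Nat.pair 0 (Nat.pair r (Nat.pair i j))
  | bot => Nat.pair 1 0
  | imp φ ψ => Nat.pair 2 (Nat.pair φ.code ψ.code)
  | all i φ => Nat.pair 3 (Nat.pair i φ.code)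

theorem code_injective : Function.Injective code := by
  intro φ
  induction φ with
  | rel r i j => intro ψ h; cases ψ <;> simp_all [code, Nat.pair_eq_pair]
  | bot => intro ψ h; cases ψ <;> simp_all [code, Nat.pair_eq_pair]
  | imp φ₁ φ₂ h₁ h₂ =>
    intro ψ h
    cases ψ <;> simp only [code, Nat.pair_eq_pair, OfNat.ofNat_ne_zero, OfNat.ofNat_ne_one,
      Nat.reduceEqDiff, false_and, true_and] at h
    rw [h₁ h.1, h₂ h.2]
  | all i φ ih =>
    intro ψ h
    cases ψ <;> simp only [code, Nat.pair_eq_pair, OfNat.ofNat_ne_zero, OfNat.ofNat_ne_one,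
      Nat.reduceEqDiff, false_and, true_and] at h
    rw [h.1, ih h.2]

instance : Countable Fm := code_injective.countable

instance : Nonempty Fm := ⟨bot⟩

/-- Negation. -/
def neg (φ : Fm) : Fm := φ.imp bot

/-- Conjunction. -/
def and (φ ψ : Fm) : Fm := (φ.imp ψ.neg).neg

/-- Disjunction. -/
def or (φ ψ : Fm) : Fm := φ.neg.imp ψ

/-- Equivalence. -/
def iff (φ ψ : Fm) : Fm := (φ.imp ψ).and (ψ.imp φ)

/-- Existential quantification. -/
def ex (i : ℕ) (φ : Fm) : Fm := (all i φ.neg).neg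

/-- Truth of a formula at a stage `t` of a frame: atoms and connectives are evaluated classically,
and quantifiers range over the objects available at all later stages. -/
def Sat {V T : Type*} (A : ℕ → V → V → Prop) (le : T → T → Prop) (N : T → V → Prop) :
    Fm → T → (ℕ → V) → Prop
  | rel r i j, _, v => A r (v i) (v j)
  | bot, _, _ => False
  | imp φ ψ, t, v => Sat A le N φ t v → Sat A le N ψ t v
  | all i φ, t, v => ∀ t', le t t' → ∀ y, N t' y → Sat A le N φ t' (Function.update v i y)

section Sat

variable {V T : Type*} (A : ℕ → V → V → Prop) (le : T → T → Prop) (N : T → V → Prop)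
  (φ ψ : Fm) (t : T) (v : ℕ → V)

@[simp] theorem sat_rel (r i j : ℕ) : Sat A le N (rel r i j) t v ↔ A r (v i) (v j) := Iff.rfl

@[simp] theorem sat_bot : Sat A le N bot t v ↔ False := Iff.rfl

@[simp] theorem sat_imp :
    Sat A le N (imp φ ψ) t v ↔ (Sat A le N φ t v → Sat A le N ψ t v) := Iff.rfl

@[simp] theorem sat_all (i : ℕ) : Sat A le N (all i φ) t v ↔
    ∀ t', le t t' → ∀ y, N t' y → Sat A le N φ t' (Function.update v i y) := Iff.rfl

@[simp] theorem sat_neg : Sat A le N φ.neg t v ↔ ¬ Sat A le N φ t v := Iff.rfl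

@[simp] theorem sat_and : Sat A le N (φ.and ψ) t v ↔ Sat A le N φ t v ∧ Sat A le N ψ t v := by
  simp [Fm.and]

@[simp] theorem sat_or : Sat A le N (φ.or ψ) t v ↔ Sat A le N φ t v ∨ Sat A le N ψ t v := by
  simp [Fm.or]; tauto

@[simp] theorem sat_iff : Sat A le N (φ.iff ψ) t v ↔ (Sat A le N φ t v ↔ Sat A le N ψ t v) := by
  simp [Fm.iff]; tauto

@[simp] theorem sat_ex (i : ℕ) : Sat A le N (ex i φ) t v ↔
    ∃ t', le t t' ∧ ∃ y, N t' y ∧ Sat A le N φ t' (Function.update v i y) := by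
  simp [Fm.ex]

end Sat

/-- Ordinary first-order truth, as truth in a frame with one stage. -/
def Tru {V : Type*} (A : ℕ → V → V → Prop) (φ : Fm) (v : ℕ → V) : Prop :=
  Sat A (fun _ _ : Unit => True) (fun _ _ => True) φ () v

section Tru

variable {V : Type*} (A : ℕ → V → V → Prop) (φ ψ : Fm) (v : ℕ → V)

@[simp] theorem tru_rel (r i j : ℕ) : Tru A (rel r i j) v ↔ A r (v i) (v j) := Iff.rfl

@[simp] theorem tru_bot : Tru A bot v ↔ False := Iff.rfl

@[simp] theorem tru_imp : Tru A (imp φ ψ) v ↔ (Tru A φ v → Tru A ψ v) := Iff.rfl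

@[simp] theorem tru_all (i : ℕ) :
    Tru A (all i φ) v ↔ ∀ y, Tru A φ (Function.update v i y) :=
  ⟨fun h y => h () trivial y trivial, fun h _ _ y _ => h y⟩

@[simp] theorem tru_neg : Tru A φ.neg v ↔ ¬ Tru A φ v := Iff.rfl

@[simp] theorem tru_and : Tru A (φ.and ψ) v ↔ Tru A φ v ∧ Tru A ψ v := by simp [Tru]

@[simp] theorem tru_or : Tru A (φ.or ψ) v ↔ Tru A φ v ∨ Tru A ψ v := by simp [Tru]

@[simp] theorem tru_iff : Tru A (φ.iff ψ) v ↔ (Tru A φ v ↔ Tru A ψ v) := by simp [Tru]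

@[simp] theorem tru_ex (i : ℕ) :
    Tru A (ex i φ) v ↔ ∃ y, Tru A φ (Function.update v i y) := by
  simp [Fm.ex]

end Tru

/-- Translation into Mathlib formulas, given the translation of atoms. -/
def toB {L : Language} {α : Type}
    (at' : ∀ n, ℕ → α ⊕ Fin n → α ⊕ Fin n → L.BoundedFormula α n) :
    Fm → ∀ n, (ℕ → α ⊕ Fin n) → L.BoundedFormula α n
  | rel r i j, n, ρ => at' n r (ρ i) (ρ j)
  | bot, _, _ => .falsum
  | imp φ ψ, n, ρ => (toB at' φ n ρ).imp (toB at' ψ n ρ)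
  | all i φ, n, ρ => (toB at' φ (n + 1)
      (Function.update (fun m => Sum.map id Fin.castSucc (ρ m)) i (Sum.inr (Fin.last n)))).all

theorem realize_toB {L : Language} {α : Type} {M : Type*} [L.Structure M]
    (at' : ∀ n, ℕ → α ⊕ Fin n → α ⊕ Fin n → L.BoundedFormula α n) (A : ℕ → M → M → Prop)
    (v : α → M)
    (h : ∀ n r a b xs, (at' n r a b).Realize v xs ↔ A r (Sum.elim v xs a) (Sum.elim v xs b))
    (φ : Fm) (n : ℕ) (ρ : ℕ → α ⊕ Fin n) (xs : Fin n → M) :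
    (toB at' φ n ρ).Realize v xs ↔ Tru A φ (Sum.elim v xs ∘ ρ) := by
  induction φ generalizing n with
  | rel r i j => simp [toB, h]
  | bot => simp [toB, BoundedFormula.Realize]
  | imp φ ψ h₁ h₂ => simp [toB, h₁, h₂]
  | all i φ ih =>
    simp only [toB, BoundedFormula.realize_all, ih, tru_all]
    refine forall_congr' fun y => ?_
    have : Sum.elim v (Fin.snoc xs y) ∘ Function.update
        (fun m => Sum.map id Fin.castSucc (ρ m)) i (Sum.inr (Fin.last n)) =
        Function.update (Sum.elim v xs ∘ ρ) i y := by
      funext m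
      by_cases hm : m = i
      · subst hm; simp
      · simp only [Function.comp, Function.update_of_ne hm]
        cases ρ m <;> simp
    rw [this]

/-- The atoms of the language `{∈}`: `0` is membership and `1` is equality. -/
def atomMem {α : Type} (n r : ℕ) (a b : α ⊕ Fin n) : Lmem.BoundedFormula α n :=
  match r with
  | 0 => Relations.boundedFormula₂ (L := Lmem) memRel.mem (Term.var a) (Term.var b)
  | 1 => Term.bdEqual (Term.var a) (Term.var b)
  | _ => .falsum

/-- The atoms of the language `{∈, j}`: additionally, `2` is the graph of `j`. -/
def atomMemj {α : Type} (n r : ℕ) (a b : α ⊕ Fin n) : Lmemj.BoundedFormula α n :=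
  match r with
  | 0 => Relations.boundedFormula₂ (L := Lmemj) memRel.mem (Term.var a) (Term.var b)
  | 1 => Term.bdEqual (Term.var a) (Term.var b)
  | 2 => Term.bdEqual (Term.var a)
      (Functions.apply₁ (L := Lmemj) (jFun.j : Lmemj.Functions 1) (Term.var b))
  | _ => .falsum

/-- The interpretation of the atoms of `{∈}`. -/
def relMem {M : Type*} (mem : M → M → Prop) (r : ℕ) (x y : M) : Prop :=
  match r with
  | 0 => mem x y
  | 1 => x = y
  | _ => False

/-- The interpretation of the atoms of `{∈, j}`. -/
def relMemj {M : Type*} (mem : M → M → Prop) (j : M → M) (r : ℕ) (x y : M) : Prop :=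
  match r with
  | 0 => mem x y
  | 1 => x = y
  | 2 => x = j y
  | _ => False

@[simp] theorem relMem_zero {M : Type*} (mem : M → M → Prop) : relMem mem 0 = mem := rfl
@[simp] theorem relMem_one {M : Type*} (mem : M → M → Prop) (x y : M) :
    relMem mem 1 x y ↔ x = y := Iff.rfl
@[simp] theorem relMemj_zero {M : Type*} (mem : M → M → Prop) (j : M → M) :
    relMemj mem j 0 = mem := rfl
@[simp] theorem relMemj_one {M : Type*} (mem : M → M → Prop) (j : M → M) (x y : M) :
    relMemj mem j 1 x y ↔ x = y := Iff.rfl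
@[simp] theorem relMemj_two {M : Type*} (mem : M → M → Prop) (j : M → M) (x y : M) :
    relMemj mem j 2 x y ↔ x = j y := Iff.rfl

/-- A formula of `{∈}` whose free variables are all read as one universally quantified one. -/
def toSentence (φ : Fm) : Lmem.Sentence := (toB atomMem φ 1 (fun _ => Sum.inr 0)).all

theorem realize_toSentence {M : Type*} (mem : M → M → Prop) (φ : Fm) :
    (letI := memStructure mem; M ⊨ φ.toSentence) ↔
      ∀ x, Tru (relMem mem) φ (fun _ => x) := by
  let := memStructure mem
  change BoundedFormula.Realize _ _ _ ↔ _
  rw [toSentence, BoundedFormula.realize_all]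
  refine forall_congr' fun x => ?_
  rw [realize_toB atomMem (relMem mem)]
  · rw [show Sum.elim (default : Empty → M) (Fin.snoc (default : Fin 0 → M) x) ∘
      (fun _ => Sum.inr 0) = fun _ => x from funext fun _ => by
        simp only [Function.comp, Sum.elim_inr]
        exact Fin.snoc_last (α := fun _ => M) x default]
  · intro n r a b xs
    match r with
    | 0 => rfl
    | 1 => simp [atomMem]
    | _ + 2 => rfl

theorem exists_sep_of_axCompJ {M : Type*} {mem : M → M → Prop} {j : M → M}
    (h : AxCompJ M mem j) (φ : Fm) (x a b : M) :
    ∃ s, ∀ z, mem z s ↔ mem z x ∧ Tru (relMemj mem j) φ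
      (fun i => if i = 0 then z else if i = 1 then a else b) := by
  let := memjStructure mem j
  obtain ⟨s, hs⟩ := h 2 (toB atomMemj φ 0
    (fun i => Sum.inl (if i = 0 then 0 else if i = 1 then 1 else 2))) x ![a, b]
  refine ⟨s, fun z => (hs z).trans (and_congr_right fun _ => ?_)⟩
  refine (realize_toB atomMemj (relMemj mem j) _ ?_ φ 0 _ _).trans (iff_of_eq (congrArg _ ?_))
  · intro n r a b xs
    match r with
    | 0 => rfl
    | 1 => simp [atomMemj]
    | 2 =>
      simp only [atomMemj, BoundedFormula.realize_bdEqual]; rfl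
    | _ + 3 => rfl
  · funext i
    simp only [Function.comp, Sum.elim_inl]
    split_ifs <;> rfl

/-- The variable named by a term of the relational language `{∈}`. -/
def varOf {m k : ℕ} : Lmem.Term (Fin m ⊕ Fin k) → ℕ
  | .var (.inl i) => i
  | .var (.inr l) => m + l
  | .func f _ => Empty.elim f

/-- Translation from Mathlib formulas of `{∈}`. -/
def fromB {m : ℕ} : ∀ {k : ℕ}, Lmem.BoundedFormula (Fin m) k → Fm
  | _, .falsum => bot
  | _, .equal s t => rel 1 (varOf s) (varOf t)
  | _, .rel (l := l) R ts =>
    match l, R, ts with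
    | _, .mem, ts => rel 0 (varOf (ts 0)) (varOf (ts 1))
  | _, .imp φ ψ => (fromB φ).imp (fromB ψ)
  | k, .all φ => Fm.all (m + k) (fromB φ)

theorem realize_fromB {M : Type*} (mem : M → M → Prop) {m k : ℕ}
    (φ : Lmem.BoundedFormula (Fin m) k) (v : Fin m → M) (xs : Fin k → M) (w : ℕ → M)
    (hv : ∀ i : Fin m, w i = v i) (hx : ∀ l : Fin k, w (m + l) = xs l) :
    (letI := memStructure mem; φ.Realize v xs) ↔ Tru (relMem mem) (fromB φ) w := by
  let := memStructure mem
  have hvar : ∀ {k : ℕ} (xs : Fin k → M) (w : ℕ → M) (hv : ∀ i : Fin m, w i = v i)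
      (hx : ∀ l : Fin k, w (m + l) = xs l) (t : Lmem.Term (Fin m ⊕ Fin k)),
      t.realize (Sum.elim v xs) = w (varOf t) := by
    intro k xs w hv hx t
    match t with
    | .var (.inl i) => simp [varOf, hv]
    | .var (.inr l) => simp [varOf, hx]
    | .func f _ => exact Empty.elim f
  change φ.Realize v xs ↔ _
  induction φ generalizing w with
  | falsum => rfl
  | equal s t =>
    simp only [BoundedFormula.Realize, fromB, tru_rel, relMem_one, hvar xs w hv hx]
  | rel R ts =>
    cases R
    change mem _ _ ↔ mem _ _
    simp only [hvar xs w hv hx]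
  | imp φ ψ h₁ h₂ => exact imp_congr (h₁ xs w hv hx) (h₂ xs w hv hx)
  | all φ ih =>
    simp only [BoundedFormula.realize_all, fromB, tru_all]
    refine forall_congr' fun y => ih _ _ (fun i => ?_) (fun l => ?_)
    · rw [Function.update_of_ne (by omega), hv]
    · refine Fin.lastCases ?_ (fun l => ?_) l
      · simp
      · rw [Function.update_of_ne (by simp; omega)]
        simp [← hx]

end Fm

section Coding

variable {M : Type*} (mem : M → M → Prop)

/-- `p` is an atom over `i`: a set `p = {p, i}` distinct from `i`. -/
def AtomOver (i p : M) : Prop := p ≠ i ∧ mem p p ∧ mem i p ∧ ∀ z, mem z p → z = p ∨ z = i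

/-- `P` is the nonempty set of all atoms over `i`. -/
def AtomSet (i P : M) : Prop := (∃ p, mem p P) ∧ ∀ p, mem p P ↔ AtomOver mem i p

/-- Some self-membered set contains `p`, `q` and `k`. -/
def Linked (p q k : M) : Prop := ∃ w, mem w w ∧ mem p w ∧ mem q w ∧ mem k w

/-- `e` behaves like the pair `{{i, j}, k}`. -/
def Codes (e i j k : M) : Prop := mem k e ∧ ∃ u, mem u e ∧ mem i u ∧ mem j u

/-- A configuration that Global Choice refutes: `I` is a set of indices, each carrying a set of
atoms, the triples of distinct elements of `I` are coded in `Tr`, and `F` is a family of sets which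
bounds the linkage of every pair of atoms but cannot bound a linkage of the indices that meets
every triple. -/
structure Config (I Tr F : M) : Prop where
  atoms : ∀ i, mem i I → ∃ P, AtomSet mem i P
  bound : ∀ i, mem i I → ∀ j, mem j I → i ≠ j → ∀ p q, AtomOver mem i p → AtomOver mem j q →
    ∃ s, mem s F ∧ ∀ k, mem k I → Linked mem p q k → mem k s
  linked : ∀ i, mem i I → ∀ j, mem j I → ∀ k, mem k I → i ≠ j → i ≠ k → j ≠ k →
    ∀ p q r, AtomOver mem i p → AtomOver mem j q → AtomOver mem k r →
      Linked mem p q k ∨ Linked mem p r j ∨ Linked mem q r i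
  free : ∀ g, (∀ i, mem i I → ∀ j, mem j I → i ≠ j → ∃ s, mem s F ∧
      ∀ k, mem k I → ∀ e, mem e g → Codes mem e i j k → mem k s) →
    ∃ i, mem i I ∧ ∃ j, mem j I ∧ ∃ k, mem k I ∧ i ≠ j ∧ i ≠ k ∧ j ≠ k ∧
      ∀ e, mem e g → ¬ Codes mem e i j k ∧ ¬ Codes mem e i k j ∧ ¬ Codes mem e j k i
  exists_code : ∀ i, mem i I → ∀ j, mem j I → ∀ k, mem k I → i ≠ j → i ≠ k → j ≠ k →
    ∃ e, mem e Tr ∧ Codes mem e i j k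
  code_unique : ∀ e, mem e Tr → ∀ i, mem i I → ∀ j, mem j I → ∀ k, mem k I →
    ∀ i', mem i' I → ∀ j', mem j' I → ∀ k', mem k' I → i ≠ j → i' ≠ j' →
    Codes mem e i j k → Codes mem e i' j' k' →
    k = k' ∧ ((i = i' ∧ j = j') ∨ (i = j' ∧ j = i'))

variable {mem}

theorem Linked.symm {p q k : M} (h : Linked mem p q k) : Linked mem q p k := by
  obtain ⟨w, h₁, h₂, h₃, h₄⟩ := h
  exact ⟨w, h₁, h₃, h₂, h₄⟩

end Coding

namespace Fm

/-- The formula expressing `AtomOver`, with bound variable `z`. -/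
def atomOver (z i p : ℕ) : Fm :=
  (rel 1 p i).neg.and ((rel 0 p p).and ((rel 0 i p).and
    (all z ((rel 0 z p).imp ((rel 1 z p).or (rel 1 z i))))))

/-- The formula expressing `AtomSet`, with bound variables `z` and `p`. -/
def atomSet (z p i P : ℕ) : Fm :=
  (ex p (rel 0 p P)).and (all p ((rel 0 p P).iff (atomOver z i p)))

/-- The formula expressing `Linked`, with bound variable `w`. -/
def linked (w p q k : ℕ) : Fm :=
  ex w ((rel 0 w w).and ((rel 0 p w).and ((rel 0 q w).and (rel 0 k w))))

/-- The formula expressing `Codes`, with bound variable `u`. -/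
def codes (u e i j k : ℕ) : Fm :=
  (rel 0 k e).and (ex u ((rel 0 u e).and ((rel 0 i u).and (rel 0 j u))))

/-- Bounded universal quantification over the elements of variable `a`. -/
def allIn (i a : ℕ) (φ : Fm) : Fm := all i ((rel 0 i a).imp φ)

/-- Bounded existential quantification over the elements of variable `a`. -/
def exIn (i a : ℕ) (φ : Fm) : Fm := ex i ((rel 0 i a).and φ)

/-- Inequality. -/
def ne (i j : ℕ) : Fm := (rel 1 i j).neg

/-- The first clause of `Config`. -/
def configAtoms : Fm := allIn 3 0 (ex 9 (atomSet 20 6 3 9))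

/-- The second clause of `Config`. -/
def configBound : Fm := allIn 3 0 (allIn 4 0 ((ne 3 4).imp (all 6 (all 7
  ((atomOver 20 3 6).imp ((atomOver 20 4 7).imp
    (exIn 10 2 (allIn 5 0 ((linked 21 6 7 5).imp (rel 0 5 10))))))))))

/-- The third clause of `Config`. -/
def configLinked : Fm := allIn 3 0 (allIn 4 0 (allIn 5 0 ((ne 3 4).imp ((ne 3 5).imp ((ne 4 5).imp
  (all 6 (all 7 (all 8 ((atomOver 20 3 6).imp ((atomOver 20 4 7).imp ((atomOver 20 5 8).imp
    ((linked 21 6 7 5).or ((linked 21 6 8 4).or (linked 21 7 8 3))))))))))))))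

/-- The fourth clause of `Config`. -/
def configFree : Fm := all 11
  ((allIn 3 0 (allIn 4 0 ((ne 3 4).imp (exIn 10 2 (allIn 5 0 (allIn 12 11
    ((codes 22 12 3 4 5).imp (rel 0 5 10)))))))).imp
  (exIn 3 0 (exIn 4 0 (exIn 5 0 ((ne 3 4).and ((ne 3 5).and ((ne 4 5).and
    (allIn 12 11 ((codes 22 12 3 4 5).neg.and
      ((codes 22 12 3 5 4).neg.and (codes 22 12 4 5 3).neg))))))))))

/-- The fifth clause of `Config`. -/
def configCode : Fm := allIn 3 0 (allIn 4 0 (allIn 5 0 ((ne 3 4).imp ((ne 3 5).imp ((ne 4 5).imp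
  (exIn 12 1 (codes 22 12 3 4 5)))))))

/-- The sixth clause of `Config`. -/
def configUnique : Fm := allIn 12 1 (allIn 3 0 (allIn 4 0 (allIn 5 0 (allIn 13 0 (allIn 14 0
  (allIn 15 0 ((ne 3 4).imp ((ne 13 14).imp ((codes 22 12 3 4 5).imp ((codes 22 12 13 14 15).imp
    ((rel 1 5 15).and (((rel 1 3 13).and (rel 1 4 14)).or
      ((rel 1 3 14).and (rel 1 4 13))))))))))))))

/-- The sentence stating that a configuration exists. -/
def config : Fm := ex 0 (ex 1 (ex 2 (configAtoms.and (configBound.and (configLinked.and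
  (configFree.and (configCode.and configUnique)))))))

/-- The formula selecting the codes of triples `i`, `j`, `k` such that the chosen atoms over `i` and
`j` are linked to `k`. -/
def selected : Fm := exIn 3 1 (exIn 4 1 (exIn 5 1 ((ne 3 4).and ((codes 22 0 3 4 5).and
  (ex 9 (ex 16 (ex 6 (ex 7 ((atomSet 20 23 3 9).and ((atomSet 20 23 4 16).and
    ((rel 2 6 9).and ((rel 2 7 16).and (linked 21 6 7 5)))))))))))))

section Tru

variable {M : Type*} {A : ℕ → M → M → Prop} (hA : ∀ x y, A 1 x y ↔ x = y) (v : ℕ → M)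

@[simp] theorem tru_allIn (i a : ℕ) (φ : Fm) : Tru A (allIn i a φ) v ↔
    ∀ y, A 0 y (Function.update v i y a) → Tru A φ (Function.update v i y) := by
  simp [allIn]

@[simp] theorem tru_exIn (i a : ℕ) (φ : Fm) : Tru A (exIn i a φ) v ↔
    ∃ y, A 0 y (Function.update v i y a) ∧ Tru A φ (Function.update v i y) := by
  simp [exIn]

include hA

theorem tru_ne (i j : ℕ) : Tru A (ne i j) v ↔ v i ≠ v j := by simp [ne, hA]

theorem tru_atomOver {z i p : ℕ} (hi : i ≠ z) (hp : p ≠ z) :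
    Tru A (atomOver z i p) v ↔ AtomOver (A 0) (v i) (v p) := by
  simp [atomOver, AtomOver, hA, Function.update_of_ne hi, Function.update_of_ne hp]

theorem tru_atomSet {z p i P : ℕ} (hi : i ≠ z) (hp : p ≠ z) (hip : i ≠ p) (hP : P ≠ p) :
    Tru A (atomSet z p i P) v ↔ AtomSet (A 0) (v i) (v P) := by
  simp [atomSet, AtomSet, tru_atomOver hA _ hi hp, Function.update_of_ne hip,
    Function.update_of_ne hP]

omit hA

theorem tru_linked {w p q k : ℕ} (hp : p ≠ w) (hq : q ≠ w) (hk : k ≠ w) :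
    Tru A (linked w p q k) v ↔ Linked (A 0) (v p) (v q) (v k) := by
  simp [linked, Linked, Function.update_of_ne hp, Function.update_of_ne hq,
    Function.update_of_ne hk]

theorem tru_codes {u e i j k : ℕ} (he : e ≠ u) (hi : i ≠ u) (hj : j ≠ u) :
    Tru A (codes u e i j k) v ↔ Codes (A 0) (v e) (v i) (v j) (v k) := by
  simp [codes, Codes, Function.update_of_ne he, Function.update_of_ne hi,
    Function.update_of_ne hj]

include hA

theorem tru_config : Tru A config v ↔ ∃ I Tr F, Config (A 0) I Tr F := by
  simp only [config, tru_ex, tru_and, configAtoms, configBound, configLinked, configFree,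
    configCode, configUnique, tru_allIn, tru_exIn, tru_imp, tru_neg, tru_or, tru_rel, tru_all,
    tru_ne hA]
  simp (disch := decide) only [tru_atomSet hA, tru_atomOver hA, tru_linked, tru_codes, hA,
    Function.update_self, Function.update_of_ne, ne_eq]
  refine exists_congr fun I => exists_congr fun Tr => exists_congr fun F =>
    ⟨fun ⟨h₁, h₂, h₃, h₄, h₅, h₆⟩ => ⟨h₁, h₂, h₃, h₄, h₅, h₆⟩,
      fun ⟨h₁, h₂, h₃, h₄, h₅, h₆⟩ => ⟨h₁, h₂, h₃, h₄, h₅, h₆⟩⟩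

end Tru

end Fm

theorem not_config_of_axGC {M : Type*} {mem : M → M → Prop} {j : M → M} (hE : AxExt M mem)
    (hj : AxGC M mem j) (hC : AxCompJ M mem j) (I Tr F : M) : ¬ Config mem I Tr F := by
  intro h
  obtain ⟨g, hg⟩ := Fm.exists_sep_of_axCompJ hC Fm.selected Tr I I
  replace hg : ∀ z, mem z g ↔ mem z Tr ∧ ∃ a, mem a I ∧ ∃ b, mem b I ∧ ∃ c, mem c I ∧ a ≠ b ∧
      Codes mem z a b c ∧ ∃ P Q p q, AtomSet mem a P ∧ AtomSet mem b Q ∧ p = j P ∧ q = j Q ∧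
        Linked mem p q c := by
    intro z
    rw [hg]
    have hA : ∀ x y, Fm.relMemj mem j 1 x y ↔ x = y := fun _ _ => Iff.rfl
    simp only [Fm.selected, Fm.tru_ex, Fm.tru_and, Fm.tru_exIn, Fm.tru_rel, Fm.tru_ne hA]
    simp (disch := decide) only [Fm.tru_atomSet hA, Fm.tru_linked, Fm.tru_codes,
      Function.update_self, Function.update_of_ne, ne_eq, if_pos, if_neg, Fm.relMemj_two,
      Fm.relMemj_zero]
  have key : ∀ a, mem a I → ∃ p, AtomOver mem a p ∧ ∀ P, AtomSet mem a P → j P = p := by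
    intro a ha
    obtain ⟨P, hP⟩ := h.atoms a ha
    refine ⟨j P, (hP.2 _).1 (hj P hP.1), fun Q hQ => ?_⟩
    rw [hE Q P fun z => (hQ.2 z).trans (hP.2 z).symm]
  choose! p hp hpP using key
  have hmem : ∀ a, mem a I → ∀ b, mem b I → ∀ c, mem c I → a ≠ b → a ≠ c → b ≠ c →
      Linked mem (p a) (p b) c → ∃ e, mem e g ∧ Codes mem e a b c := by
    intro a ha b hb c hc hab hac hbc hl
    obtain ⟨e, he, hcode⟩ := h.exists_code a ha b hb c hc hab hac hbc
    obtain ⟨P, hP⟩ := h.atoms a ha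
    obtain ⟨Q, hQ⟩ := h.atoms b hb
    exact ⟨e, (hg e).2 ⟨he, a, ha, b, hb, c, hc, hab, hcode, P, Q, p a, p b, hP, hQ,
      (hpP a ha P hP).symm, (hpP b hb Q hQ).symm, hl⟩, hcode⟩
  obtain ⟨a, ha, b, hb, c, hc, hab, hac, hbc, hno⟩ := h.free g (by
    intro a ha b hb hab
    obtain ⟨s, hs, hs'⟩ := h.bound a ha b hb hab _ _ (hp a ha) (hp b hb)
    refine ⟨s, hs, fun c hc e he hcode => hs' c hc ?_⟩
    obtain ⟨heT, a', ha', b', hb', c', hc', hab', hcode', P, Q, _, _, hP, hQ, rfl, rfl, hl⟩ :=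
      (hg e).1 he
    obtain ⟨rfl, ⟨rfl, rfl⟩ | ⟨rfl, rfl⟩⟩ :=
      h.code_unique e heT a ha b hb c hc a' ha' b' hb' c' hc' hab hab' hcode hcode'
    · rwa [hpP _ ha' P hP, hpP _ hb' Q hQ] at hl
    · rw [hpP _ ha' P hP, hpP _ hb' Q hQ] at hl
      exact hl.symm)
  rcases h.linked a ha b hb c hc hab hac hbc _ _ _ (hp a ha) (hp b hb) (hp c hc) with hl | hl | hl
  · obtain ⟨e, he, hcode⟩ := hmem a ha b hb c hc hab hac hbc hl
    exact (hno e he).1 hcode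
  · obtain ⟨e, he, hcode⟩ := hmem a ha c hc b hb hac hab hbc.symm hl
    exact (hno e he).2.1 hcode
  · obtain ⟨e, he, hcode⟩ := hmem b hb c hc a ha hbc hab.symm hac.symm hl
    exact (hno e he).2.2 hcode

/-- The index type: large enough that no finite-set-valued function on pairs meets every triple. -/
abbrev Idx : Type := ℕ ⊕ Set ℕ ⊕ Set (Set ℕ)

/-- The finitely supported `ZMod 2`-valued functions on finite sets of indices. -/
abbrev Shift : Type := Finset Idx →₀ ZMod 2

theorem Shift.add_add_cancel_right (p a : Shift) : p + a + a = p :=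
  Finsupp.ext fun τ => by simp [add_assoc, CharTwo.add_self_eq_zero]

/-- The objects from which the universe is generated. -/
inductive Base : Type
  | idx (i : Idx)
  | nat (n : ℕ)
  | atom (i : Idx) (p : Shift)
  | link (i : Idx) (p : Shift) (j : Idx) (q : Shift) (s : Finset Idx)

namespace Base

/-- The elements of a base object. -/
def ext : Base → Set Base
  | idx i => {idx i}
  | nat n => {b | ∃ m < n, b = nat m}
  | atom i p => {atom i p, idx i}
  | link i p j q s => {b | b = link i p j q s ∨ b = atom i p ∨ b = atom j q ∨ ∃ k ∈ s, b = idx k}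

theorem self_mem_ext {b : Base} (h : ∀ n, b ≠ nat n) : b ∈ ext b := by
  cases b with
  | nat n => exact (h n rfl).elim
  | _ => simp [ext]

theorem ext_nat_zero : ext (nat 0) = ∅ := by simp [ext]

theorem ext_injective : Function.Injective ext := by
  have aux : ∀ m n, m < n → ext (nat m) ≠ ext (nat n) := by
    intro m n hmn h
    have : nat m ∈ ext (nat m) := h ▸ ⟨m, hmn, rfl⟩
    obtain ⟨k, hk, he⟩ := this
    cases he
    exact hk.false
  have nat_of_mem : ∀ {b n}, b ∈ ext (nat n) → ∃ m, b = nat m := fun ⟨m, _, hm⟩ => ⟨m, hm⟩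
  intro b b' h
  by_cases hb : ∃ m, b = nat m <;> by_cases hb' : ∃ n, b' = nat n
  · obtain ⟨m, rfl⟩ := hb
    obtain ⟨n, rfl⟩ := hb'
    rcases lt_trichotomy m n with hmn | rfl | hmn
    · exact (aux _ _ hmn h).elim
    · rfl
    · exact (aux _ _ hmn h.symm).elim
  · obtain ⟨m, rfl⟩ := hb
    exact (hb' (nat_of_mem (h ▸ self_mem_ext (not_exists.1 hb')))).elim
  · obtain ⟨n, rfl⟩ := hb'
    exact (hb (nat_of_mem (h ▸ self_mem_ext (not_exists.1 hb)))).elim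
  · have h₁ : b ∈ ext b' := h ▸ self_mem_ext (not_exists.1 hb)
    have h₂ : b' ∈ ext b := h ▸ self_mem_ext (not_exists.1 hb')
    clear h
    cases b <;> cases b' <;>
      simp only [ext, Set.mem_singleton_iff, Set.mem_insert_iff, Set.mem_ofPred_eq, reduceCtorEq,
        false_or, or_false, and_false, exists_false] at h₁ h₂ <;>
      first | exact h₁ | simp at hb

/-- The code of a base object as a set of the ambient universe. -/
noncomputable def code (b : Base) : ZFSet.{0} :=
  (Order.succ (Ordinal.typein WellOrderingRel b)).toZFSet

theorem code_injective : Function.Injective code := fun _ _ h =>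
  Ordinal.typein_injective _ (Order.succ_injective (Ordinal.toZFSet_injective h))

theorem empty_mem_code (b : Base) : ∅ ∈ code b := by
  rw [code, ← Ordinal.toZFSet_zero, Ordinal.toZFSet_mem_toZFSet_iff]
  exact Order.lt_succ_of_le (zero_le)

/-- The set of codes of the elements of a base object. -/
noncomputable def extCode (b : Base) : ZFSet.{0} := ZFSet.range fun c : ext b => code c

theorem mem_extCode {b : Base} {x : ZFSet} : x ∈ extCode b ↔ ∃ c ∈ ext b, code c = x := by
  simp [extCode]

theorem extCode_injective : Function.Injective extCode := by
  intro b c h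
  refine ext_injective (Set.ext fun d => ?_)
  have := congrArg (code d ∈ ·) h
  simpa [mem_extCode, code_injective.eq_iff] using this

end Base

/-- The sets of the ambient universe which represent objects of the generated universe. -/
inductive IsUniv : ZFSet.{0} → Prop
  | code (b : Base) : IsUniv b.code
  | set (x : ZFSet) (h : ∀ y ∈ x, IsUniv y) (hx : ∀ b : Base, x ≠ b.extCode) : IsUniv x

theorem not_isUniv_empty : ¬ IsUniv ∅ := by
  have h0 : Base.extCode (.nat 0) = ∅ := by
    rw [ZFSet.eq_empty]
    simp [Base.mem_extCode, Base.ext_nat_zero]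
  generalize he : (∅ : ZFSet) = e
  intro h
  cases h with
  | code b => exact ZFSet.notMem_empty _ (he.symm ▸ Base.empty_mem_code b : ∅ ∈ (∅ : ZFSet))
  | set x h hx => exact hx _ (h0.trans he).symm

theorem ne_code_of_forall_isUniv {x : ZFSet} (h : ∀ y ∈ x, IsUniv y) (b : Base) : x ≠ b.code := by
  rintro rfl
  exact not_isUniv_empty (h _ b.empty_mem_code)

/-- The universe generated by the base objects. -/
structure Univ : Type 1 where
  /-- The representative of the object. -/
  val : ZFSet.{0}
  property : IsUniv val

namespace Univ

theorem val_ext {x y : Univ} (h : x.val = y.val) : x = y := by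
  cases x; cases y; cases h; rfl

open Classical in
/-- The set of representatives of the elements. -/
noncomputable def elts (x : ZFSet) : ZFSet :=
  if h : ∃ b : Base, x = b.code then h.choose.extCode else x

theorem elts_code (b : Base) : elts b.code = b.extCode := by
  have h : ∃ c : Base, b.code = c.code := ⟨b, rfl⟩
  rw [elts, dif_pos h, ← Base.code_injective h.choose_spec]

theorem elts_of_forall {x : ZFSet} (h : ∀ y ∈ x, IsUniv y) : elts x = x :=
  dif_neg fun ⟨b, hb⟩ => ne_code_of_forall_isUniv h b hb

/-- Membership. -/
def mem (y x : Univ) : Prop := y.1 ∈ elts x.1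

theorem mem_iff {y x : Univ} : mem y x ↔ y.1 ∈ elts x.1 := Iff.rfl

/-- The object corresponding to a base object. -/
noncomputable def base (b : Base) : Univ := ⟨b.code, .code b⟩

theorem base_injective : Function.Injective base := fun _ _ h =>
  Base.code_injective (congrArg Univ.val h)

@[simp] theorem base_inj {b c : Base} : base b = base c ↔ b = c := base_injective.eq_iff

theorem mem_base {x : Univ} {b : Base} : mem x (base b) ↔ ∃ c ∈ b.ext, x = base c := by
  rw [mem_iff, base, elts_code, Base.mem_extCode]
  exact exists_congr fun c => and_congr_right fun _ =>
    ⟨fun h => val_ext h.symm, fun h => (congrArg Univ.val h).symm⟩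

@[simp] theorem base_mem_base {b c : Base} : mem (base b) (base c) ↔ b ∈ c.ext := by
  simp [mem_base]

theorem isUniv_of_mem_elts {x y : ZFSet} (hx : IsUniv x) (h : y ∈ elts x) : IsUniv y := by
  cases hx with
  | code b =>
    rw [elts_code, Base.mem_extCode] at h
    obtain ⟨c, -, rfl⟩ := h
    exact .code c
  | set x hx _ =>
    rw [elts_of_forall hx] at h
    exact hx y h

theorem ext {x y : Univ} (h : ∀ z, mem z x ↔ mem z y) : x = y := by
  have he : elts x.1 = elts y.1 := by
    ext z
    exact ⟨fun hz => (h ⟨z, isUniv_of_mem_elts x.2 hz⟩).1 hz,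
      fun hz => (h ⟨z, isUniv_of_mem_elts y.2 hz⟩).2 hz⟩
  obtain ⟨x, hx⟩ := x
  obtain ⟨y, hy⟩ := y
  refine val_ext ?_
  dsimp only at he
  cases hx <;> cases hy
  case code.code b c =>
    rw [elts_code, elts_code] at he
    rw [Base.extCode_injective he]
  case code.set b hy hyb =>
    rw [elts_code, elts_of_forall hy] at he
    exact (hyb b he.symm).elim
  case set.code hx hxb c =>
    rw [elts_code, elts_of_forall hx] at he
    exact (hxb c he).elim
  case set.set hx _ hy _ =>
    rwa [elts_of_forall hx, elts_of_forall hy] at he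

instance small_mem (x : Univ) : Small.{0} {z | mem z x} :=
  small_of_injective (β := {z // z ∈ elts x.1}) (f := fun z => ⟨z.1.1, z.2⟩) fun a b h => by
    exact Subtype.ext (val_ext (congrArg Subtype.val h))

theorem exists_mem_iff (S : Set Univ) [Small.{0} S] : ∃ x, ∀ z, mem z x ↔ z ∈ S := by
  have hr : ∀ y ∈ ZFSet.range fun z : S => z.1.1, IsUniv y := by
    intro y hy
    obtain ⟨z, rfl⟩ := ZFSet.mem_range.1 hy
    exact z.1.2
  have hm : ∀ z : Univ, z.1 ∈ (ZFSet.range fun z : S => z.1.1) ↔ z ∈ S := by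
    intro z
    rw [ZFSet.mem_range]
    exact ⟨fun ⟨y, hy⟩ => val_ext hy ▸ y.2, fun hz => ⟨⟨z, hz⟩, rfl⟩⟩
  by_cases h : ∃ b : Base, (ZFSet.range fun z : S => z.1.1) = b.extCode
  · obtain ⟨b, hb⟩ := h
    refine ⟨base b, fun z => ?_⟩
    rw [mem_iff, base, elts_code, ← hb, hm]
  · push Not at h
    refine ⟨⟨_, .set _ hr h⟩, fun z => ?_⟩
    rw [mem_iff, elts_of_forall hr, hm]

/-- The object with a given small set of elements. -/
noncomputable def ofSet (S : Set Univ) [Small.{0} S] : Univ := (exists_mem_iff S).choose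

@[simp] theorem mem_ofSet (S : Set Univ) [Small.{0} S] (z : Univ) : mem z (ofSet S) ↔ z ∈ S :=
  (exists_mem_iff S).choose_spec z

theorem induction {P : Univ → Prop} (hb : ∀ b, P (base b))
    (hs : ∀ x, (∀ b, x ≠ base b) → (∀ z, mem z x → P z) → P x) (x : Univ) : P x := by
  obtain ⟨x, hx⟩ := x
  induction hx with
  | code b => exact hb b
  | set x h hx ih =>
    refine hs _ (fun b he => ne_code_of_forall_isUniv h b (congrArg Univ.val he)) ?_
    intro z hz
    rw [mem_iff, elts_of_forall h] at hz
    exact ih z.1 hz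

theorem mem_self {x : Univ} (h : mem x x) : ∃ b, x = base b := by
  obtain ⟨x, hx⟩ := x
  cases hx with
  | code b => exact ⟨b, rfl⟩
  | set x hx _ =>
    rw [mem_iff, elts_of_forall hx] at h
    exact (ZFSet.mem_irrefl _ h).elim

section Act

variable (σ : Base → Base)

open Classical in
/-- The action on representatives of a map on base objects. -/
noncomputable def actSet : ZFSet.{0} → ZFSet.{0} :=
  ZFSet.mem_wf.fix fun x F =>
    if h : ∃ b : Base, x = b.code then (σ h.choose).code
    else ZFSet.range fun y : {y // y ∈ x} => F y.1 y.2

theorem actSet_code (b : Base) : actSet σ b.code = (σ b).code := by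
  have h : ∃ c : Base, b.code = c.code := ⟨b, rfl⟩
  rw [actSet, ZFSet.mem_wf.fix_eq, dif_pos h, ← Base.code_injective h.choose_spec]

theorem actSet_of_forall {x : ZFSet} (h : ∀ y ∈ x, IsUniv y) :
    actSet σ x = ZFSet.range fun y : {y // y ∈ x} => actSet σ y.1 := by
  rw [actSet, ZFSet.mem_wf.fix_eq, dif_neg fun ⟨b, hb⟩ => ne_code_of_forall_isUniv h b hb]

variable (hσ : Function.Involutive σ) (he : ∀ b, ∀ c ∈ b.ext, σ c ∈ (σ b).ext)

include hσ he

theorem actSet_extCode (b : Base) : actSet σ b.extCode = (σ b).extCode := by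
  have h : ∀ y ∈ b.extCode, IsUniv y := by
    intro y hy
    obtain ⟨c, -, rfl⟩ := Base.mem_extCode.1 hy
    exact .code c
  rw [actSet_of_forall σ h]
  ext z
  simp only [ZFSet.mem_range, Subtype.exists, Base.mem_extCode]
  constructor
  · rintro ⟨_, ⟨c, hc, rfl⟩, rfl⟩
    exact ⟨σ c, he b c hc, (actSet_code σ c).symm⟩
  · rintro ⟨c, hc, rfl⟩
    refine ⟨_, ⟨σ c, ?_, rfl⟩, ?_⟩
    · simpa [hσ b] using he _ _ hc
    · rw [actSet_code, hσ c]

theorem actSet_spec {x : ZFSet} (hx : IsUniv x) :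
    IsUniv (actSet σ x) ∧ actSet σ (actSet σ x) = x := by
  induction hx with
  | code b =>
    rw [actSet_code, actSet_code, hσ b]
    exact ⟨.code _, rfl⟩
  | set x h hx ih =>
    have h' : ∀ y ∈ actSet σ x, IsUniv y := by
      intro y hy
      rw [actSet_of_forall σ h] at hy
      obtain ⟨z, rfl⟩ := ZFSet.mem_range.1 hy
      exact (ih z.1 z.2).1
    have hinv : actSet σ (actSet σ x) = x := by
      rw [actSet_of_forall σ h']
      ext z
      simp only [ZFSet.mem_range, Subtype.exists, actSet_of_forall σ h]
      constructor
      · rintro ⟨_, ⟨y, hy, rfl⟩, rfl⟩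
        rwa [(ih y hy).2]
      · intro hz
        exact ⟨_, ⟨z, hz, rfl⟩, (ih z hz).2⟩
    refine ⟨.set _ h' fun b hb => hx (σ b) ?_, hinv⟩
    rw [← hinv, hb, actSet_extCode σ hσ he]

/-- The action on the universe of an involutive automorphism of the base. -/
noncomputable def act (x : Univ) : Univ := ⟨actSet σ x.1, (actSet_spec σ hσ he x.2).1⟩

theorem act_act (x : Univ) : act σ hσ he (act σ hσ he x) = x :=
  val_ext (actSet_spec σ hσ he x.2).2

@[simp] theorem act_base (b : Base) : act σ hσ he (base b) = base (σ b) :=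
  val_ext (actSet_code σ b)

theorem act_mem {x y : Univ} (h : mem x y) : mem (act σ hσ he x) (act σ hσ he y) := by
  obtain ⟨y, hy⟩ := y
  cases hy with
  | code b =>
    obtain ⟨c, hc, rfl⟩ := mem_base.1 h
    change mem _ (act σ hσ he (base b))
    simp [he b c hc]
  | set y hy hyb =>
    have h' := (actSet_spec σ hσ he (.set y hy hyb)).1
    rw [mem_iff, elts_of_forall hy] at h
    change actSet σ x.1 ∈ elts (actSet σ y)
    have : ∀ z ∈ actSet σ y, IsUniv z := by
      intro z hz
      rw [actSet_of_forall σ hy, ZFSet.mem_range] at hz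
      obtain ⟨z, rfl⟩ := hz
      exact (actSet_spec σ hσ he (hy z.1 z.2)).1
    rw [elts_of_forall this, actSet_of_forall σ hy, ZFSet.mem_range]
    exact ⟨⟨x.1, h⟩, rfl⟩

theorem act_mem_act {x y : Univ} : mem (act σ hσ he x) (act σ hσ he y) ↔ mem x y := by
  refine ⟨fun h => ?_, act_mem σ hσ he⟩
  simpa [act_act] using act_mem σ hσ he h

theorem act_eq_self {x : Univ}
    (h : ∀ b, Relation.ReflTransGen mem (base b) x → σ b = b) : act σ hσ he x = x := by
  induction x using induction with
  | hb b => rw [act_base, h b .refl]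
  | hs x _ ih =>
    have ih' : ∀ z, mem z x → act σ hσ he z = z := fun z hz =>
      ih z hz fun b hb => h b (hb.tail hz)
    refine ext fun z => ⟨fun hz => ?_, fun hz => ?_⟩
    · have hz' : mem (act σ hσ he z) x := by
        rw [← act_mem_act σ hσ he, act_act]; exact hz
      have := ih' _ hz'
      rw [act_act] at this
      rwa [this]
    · rw [← ih' z hz]
      exact act_mem σ hσ he hz

end Act

end Univ

/-- A forcing condition: a finite set of indices together with a function which decides the
linkage of atoms over these indices. -/
@[ext] structure Cond where
  /-- The indices over which atoms are available. -/
  dom : Finset Idx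
  /-- The linkage function. -/
  fn : Idx → Idx → Idx → ZMod 2
  symm : ∀ i j k, fn i j k = fn j i k
  finite : ∀ i j, {k | fn i j k ≠ 0}.Finite
  odd : ∀ i ∈ dom, ∀ j ∈ dom, ∀ k ∈ dom, i ≠ j → i ≠ k → j ≠ k →
    fn i j k + fn i k j + fn j k i = 1

theorem triple_swap {α : Type*} [DecidableEq α] (i j k : α) :
    ({j, i, k} : Finset α) = {i, j, k} := by
  ext; simp; tauto

theorem triple_rotate {α : Type*} [DecidableEq α] (i j k : α) :
    ({i, k, j} : Finset α) = {i, j, k} := by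
  ext; simp; tauto

theorem triple_rotate' {α : Type*} [DecidableEq α] (i j k : α) :
    ({j, k, i} : Finset α) = {i, j, k} := by
  ext; simp; tauto

namespace Cond

open Classical in
/-- The action of a family of shifts on conditions. -/
noncomputable def act (a : Idx → Shift) (t : Cond) : Cond where
  dom := t.dom
  fn i j k := t.fn i j k + (a i {i, j, k} + a j {i, j, k})
  symm i j k := by
    rw [t.symm i j k, triple_swap i j k]
    ring
  finite i j := by
    have hf : ∀ b : Shift, {k | k ≠ i ∧ k ≠ j ∧ b {i, j, k} ≠ 0}.Finite := by
      intro b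
      refine Set.Finite.of_finite_image (f := fun k => ({i, j, k} : Finset Idx))
        (b.support.finite_toSet.subset ?_) ?_
      · rintro _ ⟨k, hk, rfl⟩
        simpa using hk.2.2
      · intro k hk l hl hkl
        have : k ∈ ({i, j, l} : Finset Idx) := by
          rw [← show ({i, j, k} : Finset Idx) = {i, j, l} from hkl]; simp
        simpa [hk.1, hk.2.1] using this
    refine (((t.finite i j).union ((hf (a i)).union (hf (a j)))).union
      (Set.toFinite {i, j})).subset fun k hk => ?_
    by_contra hno
    simp only [Set.mem_union, Set.mem_ofPred_eq, Set.mem_insert_iff, Set.mem_singleton_iff,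
      not_or, not_and, not_not] at hno
    obtain ⟨⟨h₁, h₂, h₃⟩, h₄, h₅⟩ := hno
    exact hk (by simp [h₁, h₂ h₄ h₅, h₃ h₄ h₅])
  odd i hi j hj k hk hij hik hjk := by
    rw [← t.odd i hi j hj k hk hij hik hjk, triple_rotate i j k, triple_rotate' i j k]
    generalize a i _ = x, a j _ = y, a k _ = z
    linear_combination (x + y + z) * CharTwo.two_eq_zero (R := ZMod 2)

theorem act_act (a : Idx → Shift) (t : Cond) : act a (act a t) = t := by
  refine Cond.ext rfl ?_
  funext i j k
  simp only [act]
  rw [add_assoc, CharTwo.add_self_eq_zero, add_zero]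

/-- Extension of conditions. -/
def le (t t' : Cond) : Prop :=
  t.dom ⊆ t'.dom ∧ ∀ i ∈ t.dom, ∀ j ∈ t.dom, ∀ k, i ≠ j → k ≠ i → k ≠ j → t.fn i j k = t'.fn i j k

theorem le_refl (t : Cond) : le t t := ⟨subset_rfl, fun _ _ _ _ _ _ _ _ => rfl⟩

theorem le_trans {r s t : Cond} (h₁ : le r s) (h₂ : le s t) : le r t :=
  ⟨h₁.1.trans h₂.1, fun i hi j hj k hij hki hkj =>
    (h₁.2 i hi j hj k hij hki hkj).trans (h₂.2 i (h₁.1 hi) j (h₁.1 hj) k hij hki hkj)⟩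

theorem act_le_act {a : Idx → Shift} {s t : Cond} (h : le s t) : le (act a s) (act a t) :=
  ⟨h.1, fun i hi j hj k hij hki hkj => by simp only [act, h.2 i hi j hj k hij hki hkj]⟩

theorem act_le_iff {a : Idx → Shift} {s t : Cond} : le (act a s) t ↔ le s (act a t) :=
  ⟨fun h => by simpa [act_act] using act_le_act (a := a) h,
    fun h => by simpa [act_act] using act_le_act (a := a) h⟩

/-- Two conditions agreeing on `E` differ on `D` by a shift that vanishes on `E`. -/
theorem exists_shift (t t' : Cond) (D E : Finset Idx) (hD : D ⊆ t.dom) (hD' : D ⊆ t'.dom)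
    (h : ∀ i ∈ E, ∀ j ∈ E, ∀ k, i ≠ j → k ≠ i → k ≠ j → t.fn i j k = t'.fn i j k) (hED : E ⊆ D) :
    ∃ a : Idx → Shift, (∀ i ∈ E, a i = 0) ∧ ∀ i ∈ D, ∀ j ∈ D, ∀ k, i ≠ j → k ≠ i → k ≠ j →
      a i {i, j, k} + a j {i, j, k} = t.fn i j k + t'.fn i j k := by
  classical
  have hx : ∀ τ : Finset Idx, ∃ x, (τ ∩ D).Nonempty →
      x ∈ τ ∩ D ∧ ((τ ∩ E).Nonempty → x ∈ E) := by
    intro τ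
    by_cases hE : (τ ∩ E).Nonempty
    · obtain ⟨x, hx⟩ := hE
      rw [Finset.mem_inter] at hx
      exact ⟨x, fun _ => ⟨Finset.mem_inter.2 ⟨hx.1, hED hx.2⟩, fun _ => hx.2⟩⟩
    · by_cases hne : (τ ∩ D).Nonempty
      · obtain ⟨x, hx⟩ := hne
        exact ⟨x, fun _ => ⟨hx, fun h => (hE h).elim⟩⟩
      · exact ⟨.inl 0, fun h => (hne h).elim⟩
  choose o ho using hx
  set d : Idx → Idx → Idx → ZMod 2 := fun i j k => t.fn i j k + t'.fn i j k with hd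
  have d_symm : ∀ i j k, d i j k = d j i k := fun i j k => by
    simp only [hd, t.symm i j k, t'.symm i j k]
  have d_odd : ∀ i ∈ D, ∀ j ∈ D, ∀ k ∈ D, i ≠ j → i ≠ k → j ≠ k →
      d i j k + d i k j + d j k i = 0 := by
    intro i hi j hj k hk hij hik hjk
    have h₁ := t.odd i (hD hi) j (hD hj) k (hD hk) hij hik hjk
    have h₂ := t'.odd i (hD' hi) j (hD' hj) k (hD' hk) hij hik hjk
    simp only [hd]
    linear_combination h₁ + h₂ + CharTwo.two_eq_zero (R := ZMod 2)
  have d_fin : ∀ i j, {k | d i j k ≠ 0}.Finite := by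
    intro i j
    refine ((t.finite i j).union (t'.finite i j)).subset fun k hk => ?_
    by_contra hno
    simp only [Set.mem_union, Set.mem_ofPred_eq, not_or, not_not] at hno
    exact hk (by simp [hd, hno.1, hno.2])
  set c : Idx → Finset Idx → ZMod 2 := fun x τ =>
    if x ∈ D ∧ x ≠ o τ then
      ∑ k ∈ τ with k ≠ x ∧ k ≠ o τ ∧ τ = {o τ, x, k}, d (o τ) x k else 0 with hc
  have hc_ne : ∀ x τ, c x τ ≠ 0 → x ∈ D ∧ x ≠ o τ ∧
      ∃ k, k ≠ x ∧ k ≠ o τ ∧ τ = {o τ, x, k} ∧ d (o τ) x k ≠ 0 := by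
    intro x τ hne
    simp only [hc] at hne
    split_ifs at hne with hx
    · obtain ⟨k, hk, hdk⟩ := Finset.exists_ne_zero_of_sum_ne_zero hne
      rw [Finset.mem_filter] at hk
      exact ⟨hx.1, hx.2, k, hk.2.1, hk.2.2.1, hk.2.2.2, hdk⟩
    · exact (hne rfl).elim
  have hc_eq : ∀ x y k : Idx, ∀ τ : Finset Idx, τ = {y, x, k} → o τ = y → x ∈ D → x ≠ y →
      k ≠ x → k ≠ y → c x τ = d y x k := by
    intro x y k τ hτ hy hx hxy hkx hky
    simp only [hc, hy]
    rw [if_pos ⟨hx, hxy⟩]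
    have : (τ.filter fun l => l ≠ x ∧ l ≠ y ∧ τ = {y, x, l}) = {k} := by
      ext l
      simp only [Finset.mem_filter, Finset.mem_singleton]
      constructor
      · rintro ⟨hl, hlx, hly, -⟩
        simpa [hτ, hlx, hly] using hl
      · rintro rfl
        exact ⟨by simp [hτ], hkx, hky, hτ⟩
    rw [this, Finset.sum_singleton]
  have hc_self : ∀ x τ, o τ = x → c x τ = 0 := by
    intro x τ hx
    simp [hc, hx]
  have hsupp : ∀ x, (Function.support (c x)).Finite := by
    intro x
    refine (Set.Finite.biUnion D.finite_toSet fun y _ =>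
      (d_fin y x).image fun k => ({y, x, k} : Finset Idx)).subset fun τ hτ => ?_
    obtain ⟨hx, -, k, -, -, hk, hdk⟩ := hc_ne x τ hτ
    have hn : (τ ∩ D).Nonempty := ⟨x, Finset.mem_inter.2 ⟨by rw [hk]; simp, hx⟩⟩
    exact Set.mem_biUnion (Finset.mem_inter.1 (ho τ hn).1).2 ⟨k, hdk, hk.symm⟩
  refine ⟨fun x => Finsupp.ofSupportFinite (c x) (hsupp x), fun i hi => ?_, ?_⟩
  · ext τ
    change c i τ = 0
    by_contra hne
    obtain ⟨hiD, hio, k, hki, hko, hk, hdk⟩ := hc_ne i τ hne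
    have hiτ : i ∈ τ := by rw [hk]; simp
    have hoE := (ho τ ⟨i, Finset.mem_inter.2 ⟨hiτ, hiD⟩⟩).2 ⟨i, Finset.mem_inter.2 ⟨hiτ, hi⟩⟩
    refine hdk ?_
    simp only [hd]
    rw [h _ hoE _ hi k hio.symm hko hki, CharTwo.add_self_eq_zero]
  · intro i hi j hj k hij hki hkj
    change c i _ + c j _ = d i j k
    have hn : (({i, j, k} : Finset Idx) ∩ D).Nonempty := ⟨i, by simp [hi]⟩
    have hτ := Finset.mem_inter.1 (ho _ hn).1
    generalize hT : ({i, j, k} : Finset Idx) = τ at hτ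
    have hoτ := hτ.1
    rw [← hT, Finset.mem_insert, Finset.mem_insert, Finset.mem_singleton, hT] at hoτ
    rcases hoτ with hoi | hoj | hok
    · rw [hc_self i τ hoi, hc_eq j i k τ hT.symm hoi hj hij.symm hkj hki, zero_add]
    · rw [hc_self j τ hoj, hc_eq i j k τ (by rw [← hT, triple_swap]) hoj hi hij hki hkj, add_zero,
        d_symm]
    · have hkD : k ∈ D := hok ▸ hτ.2
      rw [hc_eq i k j τ (by rw [← hT, triple_rotate', triple_swap]) hok hi hki.symm hij.symm
        hkj.symm, hc_eq j k i τ (by rw [← hT, triple_swap, triple_rotate']) hok hj hkj.symm hij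
        hki.symm]
      rw [d_symm k i j, d_symm k j i]
      have := d_odd i hi j hj k hkD hij hki.symm hkj.symm
      linear_combination this - d i j k * CharTwo.two_eq_zero (R := ZMod 2)

/-- Every condition can be extended to a larger domain. -/
theorem exists_le (t : Cond) (D : Finset Idx) : ∃ t', le t t' ∧ D ⊆ t'.dom := by
  classical
  let t₀ : Cond :=
    { dom := D ∪ t.dom
      fn := fun _ _ k => if k ∈ D ∪ t.dom then 1 else 0
      symm := fun _ _ _ => rfl
      finite := fun _ _ => (D ∪ t.dom).finite_toSet.subset fun k hk => by
        by_contra h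
        exact hk (if_neg h)
      odd := fun i hi j hj k hk _ _ _ => by
        rw [if_pos hi, if_pos hj, if_pos hk]
        decide }
  obtain ⟨a, -, ha⟩ := exists_shift t₀ t t.dom ∅ Finset.subset_union_right subset_rfl
    (by simp) (Finset.empty_subset _)
  refine ⟨act a t₀, ⟨Finset.subset_union_right, fun i hi j hj k hij hki hkj => ?_⟩,
    Finset.subset_union_left⟩
  simp only [act, ha i hi j hj k hij hki hkj]
  rw [← add_assoc, CharTwo.add_self_eq_zero, zero_add]

/-- Any two extensions of a condition are compatible up to a shift which vanishes on its domain. -/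
theorem amalgamation {t t' s : Cond} (h : le t t') (h' : le t s) :
    ∃ a : Idx → Shift, (∀ i ∈ t.dom, a i = 0) ∧ ∃ r, le s r ∧ le (act a t') r := by
  obtain ⟨r, hr, hdom⟩ := exists_le s t'.dom
  obtain ⟨a, ha, ha'⟩ := exists_shift r t' t'.dom t.dom hdom subset_rfl
    (fun i hi j hj k hij hki hkj => by
      rw [← (le_trans h' hr).2 i hi j hj k hij hki hkj, h.2 i hi j hj k hij hki hkj]) h.1
  refine ⟨a, ha, r, hr, hdom, fun i hi j hj k hij hki hkj => ?_⟩
  simp only [act, ha' i hi j hj k hij hki hkj]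
  linear_combination t'.fn i j k * CharTwo.two_eq_zero (R := ZMod 2)

end Cond

namespace Base

/-- The action of a family of shifts on base objects. -/
noncomputable def act (a : Idx → Shift) : Base → Base
  | idx i => idx i
  | nat n => nat n
  | atom i p => atom i (p + a i)
  | link i p j q s => link i (p + a i) j (q + a j) s

theorem act_involutive (a : Idx → Shift) : Function.Involutive (act a) := by
  intro b
  cases b <;> simp [act, Shift.add_add_cancel_right]

theorem act_mem_ext (a : Idx → Shift) (b : Base) : ∀ c ∈ b.ext, act a c ∈ (act a b).ext := by
  intro c hc
  cases b with
  | idx i => simp_all [act, ext]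
  | nat n => obtain ⟨m, hm, rfl⟩ := hc; exact ⟨m, hm, rfl⟩
  | atom i p => rcases hc with rfl | rfl <;> simp [act, ext]
  | link i p j q s =>
    rcases hc with rfl | rfl | rfl | ⟨k, hk, rfl⟩
    · exact .inl rfl
    · exact .inr (.inl rfl)
    · exact .inr (.inr (.inl rfl))
    · exact .inr (.inr (.inr ⟨k, hk, rfl⟩))

open Classical in
/-- The base objects which exist at a given condition. -/
def Allowed (t : Cond) : Base → Prop
  | idx _ => True
  | nat _ => True
  | atom i _ => i ∈ t.dom
  | link i p j q s => i ∈ t.dom ∧ j ∈ t.dom ∧ i ≠ j ∧ ∀ k, k ∈ s ↔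
      k ≠ i ∧ k ≠ j ∧ p {i, j, k} + q {i, j, k} + t.fn i j k = 1

theorem Allowed.mono {s t : Cond} (h : Cond.le s t) {b : Base} (hb : b.Allowed s) :
    b.Allowed t := by
  cases b with
  | idx => trivial
  | nat => trivial
  | atom => exact h.1 hb
  | link i p j q s =>
    obtain ⟨hi, hj, hij, hs⟩ := hb
    refine ⟨h.1 hi, h.1 hj, hij, fun k => (hs k).trans (and_congr_right fun hki =>
      and_congr_right fun hkj => ?_)⟩
    rw [h.2 i hi j hj k hij hki hkj]

theorem Allowed.act {t : Cond} {b : Base} (hb : b.Allowed t) (a : Idx → Shift) :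
    (b.act a).Allowed (t.act a) := by
  cases b with
  | idx => trivial
  | nat => trivial
  | atom => exact hb
  | link i p j q s =>
    obtain ⟨hi, hj, hij, hs⟩ := hb
    refine ⟨hi, hj, hij, fun k => (hs k).trans (and_congr_right fun hki =>
      and_congr_right fun hkj => iff_of_eq ?_)⟩
    congr 1
    simp only [Cond.act, Finsupp.add_apply]
    linear_combination -(a i {i, j, k} + a j {i, j, k}) * CharTwo.two_eq_zero (R := ZMod 2)

theorem Allowed.act_eq {t : Cond} {b : Base} (hb : b.Allowed t) {a : Idx → Shift}
    (ha : ∀ i ∈ t.dom, a i = 0) : b.act a = b := by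
  cases b with
  | idx => rfl
  | nat => rfl
  | atom i p => simp [Base.act, ha i hb]
  | link i p j q s => simp [Base.act, ha i hb.1, ha j hb.2.1]

end Base

/-- The objects which exist at a given condition. -/
def Avail (t : Cond) (x : Univ) : Prop :=
  ∀ b, Relation.ReflTransGen Univ.mem (.base b) x → b.Allowed t

theorem Avail.mono {s t : Cond} (h : Cond.le s t) {x : Univ} (hx : Avail s x) : Avail t x :=
  fun b hb => (hx b hb).mono h

theorem Avail.of_mem {t : Cond} {x y : Univ} (hx : Avail t x) (h : Univ.mem y x) : Avail t y :=
  fun b hb => hx b (hb.tail h)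

theorem Avail.allowed {t : Cond} {b : Base} (h : Avail t (.base b)) : b.Allowed t := h b .refl

theorem avail_iff {t : Cond} {x : Univ} : Avail t x ↔ ∀ y, Univ.mem y x → Avail t y := by
  refine ⟨fun h y hy => h.of_mem hy, fun h b hb => ?_⟩
  rcases hb.cases_tail with rfl | ⟨y, hby, hy⟩
  · by_cases hn : ∃ n, b = .nat n
    · obtain ⟨n, rfl⟩ := hn
      trivial
    · exact (h _ (Univ.base_mem_base.2 (Base.self_mem_ext (not_exists.1 hn)))).allowed
  · exact h y hy b hby

theorem avail_nat (t : Cond) (n : ℕ) : Avail t (.base (.nat n)) := by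
  induction n using Nat.strong_induction_on with
  | _ n ih =>
    refine avail_iff.2 fun y hy => ?_
    obtain ⟨c, ⟨m, hm, rfl⟩, rfl⟩ := Univ.mem_base.1 hy
    exact ih m hm

theorem reflTransGen_base {b : Base} (hb : ∀ n, b ≠ .nat n) {x : Univ}
    (h : Relation.ReflTransGen Univ.mem x (.base b)) :
    ∃ c, x = .base c ∧ (c = b ∨ c ∈ b.ext ∨ ∃ i, c = .idx i) := by
  induction h using Relation.ReflTransGen.head_induction_on with
  | refl => exact ⟨b, rfl, .inl rfl⟩
  | head hxy _ ih =>
    obtain ⟨c, rfl, hc⟩ := ih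
    obtain ⟨d, hd, rfl⟩ := Univ.mem_base.1 hxy
    refine ⟨d, rfl, ?_⟩
    have key : ∀ i p, d ∈ (Base.atom i p).ext → Base.atom i p ∈ b.ext →
        d = b ∨ d ∈ b.ext ∨ ∃ i, d = .idx i := by
      rintro i p (rfl | rfl) h
      · exact .inr (.inl h)
      · exact .inr (.inr ⟨i, rfl⟩)
    rcases hc with rfl | hc | ⟨i, rfl⟩
    · exact .inr (.inl hd)
    · cases b with
      | idx i => cases hc; exact .inr (.inl hd)
      | nat n => exact (hb n rfl).elim
      | atom i p =>
        rcases hc with rfl | rfl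
        · exact .inr (.inl hd)
        · exact .inr (.inr ⟨i, hd⟩)
      | link i p j q s =>
        rcases id hc with rfl | rfl | rfl | ⟨k, hk, rfl⟩
        · exact .inr (.inl hd)
        · exact key _ _ hd hc
        · exact key _ _ hd hc
        · exact .inr (.inr ⟨k, hd⟩)
    · exact .inr (.inr ⟨i, hd⟩)

theorem avail_base {t : Cond} {b : Base} : Avail t (.base b) ↔ b.Allowed t := by
  refine ⟨fun h => h.allowed, fun h => ?_⟩
  by_cases hn : ∃ n, b = .nat n
  · obtain ⟨n, rfl⟩ := hn
    exact avail_nat t n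
  · intro c hc
    obtain ⟨c', he, hc'⟩ := reflTransGen_base (not_exists.1 hn) hc
    obtain rfl := Univ.base_injective he
    rcases hc' with rfl | hc' | ⟨i, rfl⟩
    · exact h
    · cases b with
      | idx i => cases hc'; trivial
      | nat n => exact (hn ⟨n, rfl⟩).elim
      | atom i p =>
        rcases hc' with rfl | rfl
        · exact h
        · trivial
      | link i p j q s =>
        rcases hc' with rfl | rfl | rfl | ⟨k, hk, rfl⟩
        · exact h
        · exact h.1
        · exact h.2.1
        · trivial
    · trivial

/-- The action of a family of shifts on the universe. -/
noncomputable def shift (a : Idx → Shift) : Univ → Univ :=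
  Univ.act (Base.act a) (Base.act_involutive a) (Base.act_mem_ext a)

theorem shift_shift (a : Idx → Shift) (x : Univ) : shift a (shift a x) = x :=
  Univ.act_act _ _ _ x

theorem shift_base (a : Idx → Shift) (b : Base) : shift a (.base b) = .base (b.act a) :=
  Univ.act_base _ _ _ b

theorem shift_mem_shift (a : Idx → Shift) {x y : Univ} :
    Univ.mem (shift a x) (shift a y) ↔ Univ.mem x y := Univ.act_mem_act _ _ _

theorem shift_injective (a : Idx → Shift) : Function.Injective (shift a) :=
  Function.LeftInverse.injective (shift_shift a)

theorem Avail.shift {t : Cond} {x : Univ} (hx : Avail t x) (a : Idx → Shift) :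
    Avail (t.act a) (shift a x) := by
  intro b hb
  have : Relation.ReflTransGen Univ.mem (.base (b.act a)) x := by
    have : Relation.ReflTransGen Univ.mem (_root_.shift a (.base b))
        (_root_.shift a (_root_.shift a x)) :=
      hb.lift (_root_.shift a) fun _ _ h => (shift_mem_shift a).2 h
    rwa [shift_base, shift_shift] at this
  have h := (hx _ this).act a
  rwa [Base.act_involutive a b] at h

theorem avail_act_iff {t : Cond} {x : Univ} {a : Idx → Shift} :
    Avail (t.act a) x ↔ Avail t (shift a x) :=
  ⟨fun h => by simpa [Cond.act_act] using h.shift a,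
    fun h => by simpa [shift_shift] using h.shift a⟩

theorem Avail.shift_eq {t : Cond} {x : Univ} (hx : Avail t x) {a : Idx → Shift}
    (ha : ∀ i ∈ t.dom, a i = 0) : _root_.shift a x = x :=
  Univ.act_eq_self _ _ _ fun b hb => (hx b hb).act_eq ha

/-- Truth at a condition in the universe. -/
def Holds (φ : Fm) (t : Cond) (v : ℕ → Univ) : Prop :=
  φ.Sat (Fm.relMem Univ.mem) Cond.le Avail t v

theorem holds_all {i : ℕ} {φ : Fm} {t : Cond} {v : ℕ → Univ} : Holds (.all i φ) t v ↔
    ∀ t', Cond.le t t' → ∀ y, Avail t' y → Holds φ t' (Function.update v i y) := Iff.rfl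

theorem holds_act {φ : Fm} {t : Cond} {v : ℕ → Univ} (a : Idx → Shift) :
    Holds φ (t.act a) (shift a ∘ v) ↔ Holds φ t v := by
  induction φ generalizing t v with
  | rel r i j =>
    match r with
    | 0 => exact shift_mem_shift a
    | 1 => exact (shift_injective a).eq_iff
    | _ + 2 => exact Iff.rfl
  | bot => exact Iff.rfl
  | imp φ ψ h₁ h₂ => exact imp_congr h₁ h₂
  | all i φ ih =>
    rw [holds_all, holds_all]
    constructor
    · intro h t' ht y hy
      have := h (t'.act a) (Cond.act_le_act ht) (shift a y) (hy.shift a)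
      rwa [← Function.comp_update, ih] at this
    · intro h t' ht y hy
      have := h (t'.act a) (Cond.act_le_iff.1 ht) (shift a y) (hy.shift a)
      rw [← ih, Function.comp_update, shift_shift, Cond.act_act] at this
      exact this

theorem holds_mono {φ : Fm} {s t : Cond} {v : ℕ → Univ} (h : Cond.le t s)
    (hv : ∀ n, Avail t (v n)) : Holds φ t v ↔ Holds φ s v := by
  induction φ generalizing s t v with
  | rel => exact Iff.rfl
  | bot => exact Iff.rfl
  | imp φ ψ h₁ h₂ => exact imp_congr (h₁ h hv) (h₂ h hv)
  | all i φ ih =>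
    refine ⟨fun H t' ht => H t' (Cond.le_trans h ht), fun H t' ht y hy => ?_⟩
    obtain ⟨a, ha, r, hsr, hr⟩ := Cond.amalgamation ht h
    have hv' : shift a ∘ v = v := funext fun n => (hv n).shift_eq ha
    have hu : Function.update v i (shift a y) = shift a ∘ Function.update v i y := by
      rw [Function.comp_update, hv']
    have h₁ := H r hsr (shift a y) ((hy.shift a).mono hr)
    change Holds φ r _ at h₁
    rw [hu, ← ih hr, holds_act] at h₁
    · exact h₁
    · intro n
      refine Avail.shift ?_ a
      rcases eq_or_ne n i with rfl | hn
      · simpa using hy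
      · rw [Function.update_of_ne hn]
        exact (hv n).mono ht

/-- A Henkin construction: an increasing sequence of stages and a sequence of objects such that
every task is treated infinitely often. -/
theorem exists_chain {T V Task : Type*} [Countable Task] [Nonempty Task] {le : T → T → Prop}
    {N : T → V → Prop} (hN : ∀ t t' x, le t t' → N t x → N t' x)
    (Good : Task → T → (ℕ → V) → T → V → Prop)
    (step : ∀ τ t y, (∀ n, N t (y n)) → ∃ t' z, le t t' ∧ N t' z ∧ Good τ t y t' z)
    (t₀ : T) (d : V) (hd : N t₀ d) :
    ∃ (t : ℕ → T) (y : ℕ → V), t 0 = t₀ ∧ y 0 = d ∧ (∀ m, le (t m) (t (m + 1))) ∧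
      (∀ m, N (t m) (y m)) ∧ ∀ τ b, ∃ m, b ≤ m ∧
        Good τ (t m) (fun k => if k ≤ m then y k else d) (t (m + 1)) (y (m + 1)) := by
  obtain ⟨e, he⟩ := exists_surjective_nat Task
  have : Nonempty V := ⟨d⟩
  have : Nonempty T := ⟨t₀⟩
  choose! t' z hle hz hgood using step
  let S := {p : T × (ℕ → V) // ∀ n, N p.1 (p.2 n)}
  let next : ℕ → S → S := fun m p =>
    ⟨(t' (e m.unpair.1) p.1.1 p.1.2,
      Function.update p.1.2 (m + 1) (z (e m.unpair.1) p.1.1 p.1.2)), fun n => by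
        rcases eq_or_ne n (m + 1) with rfl | hn
        · simpa using hz _ _ _ p.2
        · simpa [hn] using hN _ _ _ (hle _ _ _ p.2) (p.2 n)⟩
  let s : ℕ → S := fun m => Nat.rec ⟨(t₀, fun _ => d), fun _ => hd⟩ next m
  have hs : ∀ m, s (m + 1) = next m (s m) := fun m => rfl
  have hy : ∀ m, (s m).1.2 = fun k => if k ≤ m then (s k).1.2 k else d := by
    intro m
    induction m with
    | zero =>
      funext k
      split_ifs with hk
      · rw [Nat.le_zero.1 hk]
      · rfl
    | succ m ih =>
      funext k
      rcases eq_or_ne k (m + 1) with rfl | hk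
      · simp
      · have : k ≤ m + 1 ↔ k ≤ m := by omega
        simp only [hs, next, Function.update_of_ne hk, ih, this]
  refine ⟨fun m => (s m).1.1, fun m => (s m).1.2 m, rfl, rfl, fun m => hle _ _ _ (s m).2,
    fun m => (s m).2 m, fun τ b => ?_⟩
  obtain ⟨c, rfl⟩ := he τ
  refine ⟨Nat.pair c b, Nat.right_le_pair c b, ?_⟩
  have := hgood (e c) _ _ (s (Nat.pair c b)).2
  rw [← hy]
  simpa [hs, next] using this

/-- The set of elements of `x` with a definable property. -/
noncomputable def sep (x : Univ) (P : Univ → Prop) : Univ :=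
  haveI : Small.{0} {z | Univ.mem z x ∧ P z} :=
    small_subset (s := {z | Univ.mem z x}) fun _ h => h.1
  Univ.ofSet {z | Univ.mem z x ∧ P z}

theorem mem_sep {x z : Univ} {P : Univ → Prop} :
    Univ.mem z (sep x P) ↔ Univ.mem z x ∧ P z := by
  simp [sep]

theorem exists_model (t₀ : Cond) : ∃ (M : Type) (mem : M → M → Prop), AxComp M mem ∧
    ∃ x : M, ∀ φ : Fm, Holds φ t₀ (fun _ => .base (.nat 0)) →
      φ.Tru (Fm.relMem mem) (fun _ => x) := by
  classical
  obtain ⟨t, y, rfl, hy0, ht, hy, htask⟩ := exists_chain (le := Cond.le) (N := Avail)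
    (Task := Bool × Fm × ℕ × ℕ × (ℕ →₀ ℕ)) (fun t t' x h hx => hx.mono h)
    (fun τ t y t' z => match τ with
      | (true, φ, i, _, ρ) => ¬ Holds (.all i φ) t (y ∘ ρ) →
          ¬ Holds φ t' (Function.update (y ∘ ρ) i z)
      | (false, φ, i, j, ρ) => ∀ w, Univ.mem w z ↔
          Univ.mem w (y (ρ j)) ∧ Holds φ t (Function.update (y ∘ ρ) i w))
    (by
      rintro ⟨_ | _, φ, i, j, ρ⟩ t y hy
      · exact ⟨t, sep (y (ρ j)) fun w => Holds φ t (Function.update (y ∘ ρ) i w), Cond.le_refl t,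
          avail_iff.2 fun w hw => (hy _).of_mem (mem_sep.1 hw).1, fun w => mem_sep⟩
      · by_cases h : Holds (.all i φ) t (y ∘ ρ)
        · exact ⟨t, y 0, Cond.le_refl t, hy 0, fun h' => (h' h).elim⟩
        · rw [holds_all] at h
          push Not at h
          obtain ⟨t', htt, z, hz, h⟩ := h
          exact ⟨t', z, htt, hz, fun _ => h⟩)
    t₀ (.base (.nat 0)) (avail_nat _ 0)
  have hmono : ∀ {m n}, m ≤ n → Cond.le (t m) (t n) := fun h =>
    Nat.le_induction (Cond.le_refl _) (fun n _ ih => Cond.le_trans ih (ht n)) _ h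
  have hav : ∀ {m k}, k ≤ m → Avail (t m) (y k) := fun h => (hy _).mono (hmono h)
  have htrunc : ∀ {m : ℕ} {ρ : ℕ → ℕ}, (∀ n, ρ n ≤ m) →
      (fun k => if k ≤ m then y k else .base (.nat 0)) ∘ ρ = y ∘ ρ := fun h =>
    funext fun n => if_pos (h n)
  let M := Shrink.{0} (Set.range y)
  let ι : M → Univ := fun a => ((equivShrink (Set.range y)).symm a).1
  have hι : Function.Injective ι :=
    Subtype.val_injective.comp (equivShrink (Set.range y)).symm.injective
  have hιy : ∀ a, ∃ k, ι a = y k := fun a => by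
    obtain ⟨k, hk⟩ := ((equivShrink (Set.range y)).symm a).2
    exact ⟨k, hk.symm⟩
  have hyι : ∀ k, ∃ a, ι a = y k := fun k =>
    ⟨equivShrink _ ⟨y k, k, rfl⟩, by simp [ι]⟩
  let mem : M → M → Prop := fun a b => Univ.mem (ι a) (ι b)
  have hupd : ∀ (ρ : ℕ →₀ ℕ) i k, Function.update (y ∘ ρ) i (y k) = y ∘ ρ.update i k := by
    intro ρ i k
    rw [Finsupp.coe_update, Function.comp_update]
  have hbd : ∀ {ρ : ℕ →₀ ℕ} {i k m : ℕ}, (∀ n, ρ n ≤ m) → k ≤ m → ∀ n, ρ.update i k n ≤ m := by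
    intro ρ i k m h hk n
    rw [Finsupp.coe_update]
    rcases eq_or_ne n i with rfl | hn
    · simpa using hk
    · simpa [hn] using h n
  have truth : ∀ (φ : Fm) (ρ : ℕ →₀ ℕ) (e : ℕ → M) (m : ℕ), (∀ n, ι (e n) = y (ρ n)) →
      (∀ n, ρ n ≤ m) → (φ.Tru (Fm.relMem mem) e ↔ Holds φ (t m) (y ∘ ρ)) := by
    intro φ
    induction φ with
    | rel r i j =>
      intro ρ e m he _
      match r with
      | 0 =>
        change Univ.mem _ _ ↔ Univ.mem _ _
        rw [he, he]; rfl
      | 1 =>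
        change _ = _ ↔ _ = _
        rw [← hι.eq_iff, he, he]; rfl
      | _ + 2 => exact Iff.rfl
    | bot => exact fun _ _ _ _ _ => Iff.rfl
    | imp φ ψ h₁ h₂ => exact fun ρ e m he hm => imp_congr (h₁ ρ e m he hm) (h₂ ρ e m he hm)
    | all i φ ih =>
      intro ρ e m he hm
      have he' : ∀ x k, ι x = y k → ∀ n, ι (Function.update e i x n) = y (ρ.update i k n) := by
        intro x k hx n
        rw [Finsupp.coe_update]
        rcases eq_or_ne n i with rfl | hn
        · simpa using hx
        · simpa [hn] using he n
      rw [Fm.tru_all]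
      constructor
      · intro h
        by_contra hno
        obtain ⟨m', hm', hgood⟩ := htask (true, φ, i, 0, ρ) m
        dsimp only at hgood
        rw [htrunc fun n => (hm n).trans hm',
          ← holds_mono (v := y ∘ ρ) (hmono hm') fun n => hav (hm n), hupd] at hgood
        obtain ⟨x, hx⟩ := hyι (m' + 1)
        refine hgood hno ((ih _ _ (m' + 1) (he' x _ hx) (hbd (fun n => ?_) le_rfl)).1 (h x))
        exact (hm n).trans (hm'.trans (Nat.le_succ _))
      · intro h x
        obtain ⟨k, hk⟩ := hιy x
        rw [ih _ _ (max m k) (he' x k hk) (hbd (fun n => (hm n).trans (le_max_left _ _))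
          (le_max_right _ _)), ← hupd]
        exact h _ (hmono (le_max_left _ _)) _ (hav (le_max_right _ _))
  obtain ⟨x₀, hx₀⟩ := hyι 0
  refine ⟨M, mem, ?_, x₀, fun φ h => ?_⟩
  · intro n φ x p
    choose idx hidx using hιy
    let ρ : ℕ →₀ ℕ := Finsupp.onFinset (Finset.range (n + 2))
      (fun l => if h : 1 ≤ l ∧ l ≤ n then idx (p ⟨l - 1, by omega⟩) else
        if l = n + 1 then idx x else 0) (by
          intro l hl
          by_contra hno
          rw [Finset.mem_range] at hno
          rw [dif_neg (by omega), if_neg (by omega)] at hl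
          exact hl rfl)
    let e : ℕ → M := fun l => if h : 1 ≤ l ∧ l ≤ n then p ⟨l - 1, by omega⟩ else
      if l = n + 1 then x else x₀
    have he : ∀ l, ι (e l) = y (ρ l) := by
      intro l
      simp only [e, ρ, Finsupp.onFinset_apply]
      split_ifs
      · exact hidx _
      · exact hidx _
      · exact hx₀
    obtain ⟨m, hm⟩ : ∃ m, ∀ l, ρ l ≤ m :=
      ⟨ρ.support.sup ρ, fun l => by
        by_cases hl : l ∈ ρ.support
        · exact Finset.le_sup hl
        · simp [Finsupp.notMem_support_iff.1 hl]⟩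
    obtain ⟨m', hm', hgood⟩ := htask (false, Fm.fromB φ, 0, n + 1, ρ) m
    dsimp only at hgood
    have hm'' := fun l => (hm l).trans hm'
    rw [htrunc hm'', if_pos (hm'' _)] at hgood
    have hx : y (ρ (n + 1)) = ι x := by
      rw [← he]
      simp [e]
    rw [hx] at hgood
    obtain ⟨s, hs⟩ := hyι (m' + 1)
    refine ⟨s, fun z => ?_⟩
    change Univ.mem (ι z) (ι s) ↔ _
    rw [hs, hgood]
    refine and_congr_right fun hz => ?_
    have hzav : Avail (t m') (ι z) := by
      rw [← hx] at hz
      exact (hav (hm'' _)).of_mem hz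
    have hw := fun l => show ι (Function.update e 0 z l) = y (ρ.update 0 (idx z) l) by
      rw [Finsupp.coe_update]
      rcases eq_or_ne l 0 with rfl | hl
      · simpa using hidx z
      · simpa [hl] using he l
    have hr := Fm.realize_fromB mem φ (Fin.cons z p) default (Function.update e 0 z)
      (fun l => by
        refine Fin.cases ?_ (fun l => ?_) l
        · simp
        · rw [Function.update_of_ne (by simp)]
          have : l.1 + 1 ≤ n := l.2
          simp [e, this]) (fun l => l.elim0)
    refine Iff.trans ?_ hr.symm
    rw [truth _ _ _ (max m' (idx z)) hw (hbd (fun l => (hm'' l).trans (le_max_left _ _))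
      (le_max_right _ _)), ← hupd, ← hidx z]
    refine holds_mono (hmono (le_max_left _ _)) fun l => ?_
    rcases eq_or_ne l 0 with rfl | hl
    · simpa using hzav
    · simpa [hl] using hav (hm'' l)
  · refine (truth φ 0 _ 0 (fun _ => hx₀) (fun _ => le_rfl)).2 ?_
    have : y ∘ (0 : ℕ →₀ ℕ) = fun _ => .base (.nat 0) := funext fun _ => hy0
    rw [this]
    exact h

namespace Fm

/-- The sentence expressing `AxExt`. -/
def axExt : Fm := all 0 (all 1 ((all 2 ((rel 0 2 0).iff (rel 0 2 1))).imp (rel 1 0 1)))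

/-- The sentence expressing `AxPairing`. -/
def axPairing : Fm :=
  all 0 (all 1 (ex 2 (all 3 ((rel 0 3 2).iff ((rel 1 3 0).or (rel 1 3 1))))))

/-- The sentence expressing `AxUnion`. -/
def axUnion : Fm :=
  all 0 (ex 1 (all 2 ((rel 0 2 1).iff (ex 3 ((rel 0 2 3).and (rel 0 3 0))))))

/-- The sentence expressing `AxPower`. -/
def axPower : Fm :=
  all 0 (ex 1 (all 2 ((rel 0 2 1).iff (all 3 ((rel 0 3 2).imp (rel 0 3 0))))))

/-- The sentence expressing `AxInfinity`. -/
def axInfinity : Fm := ex 0 ((ex 1 ((rel 0 1 0).and (all 2 (rel 0 2 1).neg))).and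
  (all 1 ((rel 0 1 0).imp (ex 2 ((rel 0 2 0).and
    (all 3 ((rel 0 3 2).iff ((rel 0 3 1).or (rel 1 3 1)))))))))

/-- The sentence expressing `AxChoice`. -/
def axChoice : Fm := all 0 ((all 1 ((rel 0 1 0).imp (ex 2 (rel 0 2 1)))).imp
  ((all 1 (all 2 ((rel 0 1 0).imp ((rel 0 2 0).imp
    ((ex 3 ((rel 0 3 1).and (rel 0 3 2))).imp (rel 1 1 2)))))).imp
  (ex 4 (all 1 ((rel 0 1 0).imp (ex 3 (((rel 0 3 1).and (rel 0 3 4)).and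
    (all 5 (((rel 0 5 1).and (rel 0 5 4)).imp (rel 1 5 3))))))))))

section Tru

variable {M : Type*} {mem : M → M → Prop} {v : ℕ → M}

theorem tru_axExt : Tru (relMem mem) axExt v ↔ AxExt M mem := by
  simp (disch := decide) only [axExt, AxExt, tru_all, tru_imp, tru_iff, tru_rel, relMem_zero,
    relMem_one, Function.update_self, Function.update_of_ne]

theorem tru_axPairing : Tru (relMem mem) axPairing v ↔ AxPairing M mem := by
  simp (disch := decide) only [axPairing, AxPairing, tru_all, tru_ex, tru_or, tru_iff, tru_rel,
    relMem_zero, relMem_one, Function.update_self, Function.update_of_ne]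

theorem tru_axUnion : Tru (relMem mem) axUnion v ↔ AxUnion M mem := by
  simp (disch := decide) only [axUnion, AxUnion, tru_all, tru_ex, tru_and, tru_iff, tru_rel,
    relMem_zero, Function.update_self, Function.update_of_ne]

theorem tru_axPower : Tru (relMem mem) axPower v ↔ AxPower M mem := by
  simp (disch := decide) only [axPower, AxPower, tru_all, tru_ex, tru_imp, tru_iff, tru_rel,
    relMem_zero, Function.update_self, Function.update_of_ne]

theorem tru_axInfinity : Tru (relMem mem) axInfinity v ↔ AxInfinity M mem := by
  simp (disch := decide) only [axInfinity, AxInfinity, tru_all, tru_ex, tru_and, tru_or, tru_neg,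
    tru_imp, tru_iff, tru_rel, relMem_zero, relMem_one, Function.update_self,
    Function.update_of_ne]

theorem tru_axChoice : Tru (relMem mem) axChoice v ↔ AxChoice M mem := by
  simp (disch := decide) only [axChoice, AxChoice, tru_all, tru_ex, tru_and, tru_imp, tru_rel,
    relMem_zero, relMem_one, Function.update_self, Function.update_of_ne, ExistsUnique]

end Tru

end Fm

namespace Univ

theorem small_subsets (x : Univ) : Small.{0} {z | ∀ w, mem w z → mem w x} :=
  small_of_injective (β := Set {w | mem w x}) (f := fun z => {w | mem w.1 z.1})
    fun a b h => Subtype.ext <| ext fun w =>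
      ⟨fun hw => (Set.ext_iff.1 h ⟨w, a.2 w hw⟩).1 hw,
        fun hw => (Set.ext_iff.1 h ⟨w, b.2 w hw⟩).2 hw⟩

theorem small_union (x : Univ) : Small.{0} {z | ∃ w, mem z w ∧ mem w x} := by
  refine small_subset (s := ⋃ w : {w | mem w x}, {z | mem z w.1}) ?_
  rintro z ⟨w, hz, hw⟩
  exact Set.mem_iUnion.2 ⟨⟨w, hw⟩, hz⟩

end Univ

section Axioms

variable {t : Cond} {v : ℕ → Univ}

theorem holds_axExt : Holds .axExt t v := by
  simp (disch := decide) only [Holds, Fm.axExt, Fm.sat_all, Fm.sat_imp, Fm.sat_iff, Fm.sat_rel,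
    Fm.relMem_zero, Fm.relMem_one, Function.update_self, Function.update_of_ne]
  intro t₁ _ x hx t₂ h₂ y hy h
  refine Univ.ext fun z => ⟨fun hz => ?_, fun hz => ?_⟩
  · exact (h t₂ (Cond.le_refl _) z ((hx.mono h₂).of_mem hz)).1 hz
  · exact (h t₂ (Cond.le_refl _) z (hy.of_mem hz)).2 hz

theorem holds_axPairing : Holds .axPairing t v := by
  simp (disch := decide) only [Holds, Fm.axPairing, Fm.sat_all, Fm.sat_ex, Fm.sat_or, Fm.sat_iff,
    Fm.sat_rel, Fm.relMem_zero, Fm.relMem_one, Function.update_self, Function.update_of_ne]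
  intro t₁ _ x hx t₂ h₂ y hy
  refine ⟨t₂, Cond.le_refl _, Univ.ofSet {x, y}, avail_iff.2 fun z hz => ?_, fun _ _ z _ => ?_⟩
  · rcases (Univ.mem_ofSet _ _).1 hz with rfl | rfl
    exacts [hx.mono h₂, hy]
  · simp

theorem holds_axUnion : Holds .axUnion t v := by
  simp (disch := decide) only [Holds, Fm.axUnion, Fm.sat_all, Fm.sat_ex, Fm.sat_and, Fm.sat_iff,
    Fm.sat_rel, Fm.relMem_zero, Function.update_self, Function.update_of_ne]
  intro t₁ _ x hx
  have := Univ.small_union x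
  refine ⟨t₁, Cond.le_refl _, Univ.ofSet {z | ∃ w, Univ.mem z w ∧ Univ.mem w x},
    avail_iff.2 fun z hz => ?_, fun t₂ h₂ z _ => ?_⟩
  · obtain ⟨w, hz, hw⟩ := (Univ.mem_ofSet _ _).1 hz
    exact (hx.of_mem hw).of_mem hz
  · rw [Univ.mem_ofSet]
    exact ⟨fun ⟨w, hz, hw⟩ => ⟨t₂, Cond.le_refl _, w, (hx.mono h₂).of_mem hw, hz, hw⟩,
      fun ⟨_, _, w, _, hz, hw⟩ => ⟨w, hz, hw⟩⟩

theorem holds_axPower : Holds .axPower t v := by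
  simp (disch := decide) only [Holds, Fm.axPower, Fm.sat_all, Fm.sat_ex, Fm.sat_imp, Fm.sat_iff,
    Fm.sat_rel, Fm.relMem_zero, Function.update_self, Function.update_of_ne]
  intro t₁ _ x hx
  have := Univ.small_subsets x
  refine ⟨t₁, Cond.le_refl _, Univ.ofSet {z | ∀ w, Univ.mem w z → Univ.mem w x},
    avail_iff.2 fun z hz => avail_iff.2 fun w hw => ?_, fun t₂ _ z hz => ?_⟩
  · exact hx.of_mem ((Univ.mem_ofSet _ _).1 hz w hw)
  · rw [Univ.mem_ofSet]
    exact ⟨fun h _ _ w _ => h w, fun h w hw => h t₂ (Cond.le_refl _) w (hz.of_mem hw) hw⟩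

theorem holds_axInfinity : Holds .axInfinity t v := by
  simp (disch := decide) only [Holds, Fm.axInfinity, Fm.sat_all, Fm.sat_ex, Fm.sat_imp, Fm.sat_iff,
    Fm.sat_and, Fm.sat_or, Fm.sat_neg, Fm.sat_rel, Fm.relMem_zero, Fm.relMem_one,
    Function.update_self, Function.update_of_ne]
  have hmem : ∀ z, Univ.mem z (Univ.ofSet (Set.range fun n => Univ.base (.nat n))) ↔
      ∃ n, Univ.base (.nat n) = z := fun z => by simp
  refine ⟨t, Cond.le_refl _, Univ.ofSet (Set.range fun n => Univ.base (.nat n)),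
    avail_iff.2 fun z hz => ?_, ⟨t, Cond.le_refl _, .base (.nat 0), avail_nat t 0,
      (hmem _).2 ⟨0, rfl⟩, fun _ _ z _ hz => ?_⟩, fun t₁ _ x _ hx => ?_⟩
  · obtain ⟨n, rfl⟩ := (hmem z).1 hz
    exact avail_nat t n
  · obtain ⟨c, ⟨m, hm, -⟩, -⟩ := Univ.mem_base.1 hz
    exact absurd hm (Nat.not_lt_zero m)
  · obtain ⟨n, rfl⟩ := (hmem x).1 hx
    refine ⟨t₁, Cond.le_refl _, .base (.nat (n + 1)), avail_nat t₁ _, (hmem _).2 ⟨_, rfl⟩,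
      fun _ _ z _ => ?_⟩
    rw [Univ.mem_base, Univ.mem_base]
    constructor
    · rintro ⟨_, ⟨m, hm, rfl⟩, rfl⟩
      rcases Nat.lt_succ_iff_lt_or_eq.1 hm with hm | rfl
      · exact .inl ⟨_, ⟨m, hm, rfl⟩, rfl⟩
      · exact .inr rfl
    · rintro (⟨_, ⟨m, hm, rfl⟩, rfl⟩ | rfl)
      · exact ⟨_, ⟨m, hm.trans (Nat.lt_succ_self n), rfl⟩, rfl⟩
      · exact ⟨_, ⟨n, Nat.lt_succ_self n, rfl⟩, rfl⟩

theorem holds_axChoice : Holds .axChoice t v := by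
  simp (disch := decide) only [Holds, Fm.axChoice, Fm.sat_all, Fm.sat_ex, Fm.sat_imp,
    Fm.sat_and, Fm.sat_rel, Fm.relMem_zero, Fm.relMem_one,
    Function.update_self, Function.update_of_ne]
  intro t₁ _ F hF hne hdisj
  have hne' : ∀ a, ∃ b, Univ.mem a F → Univ.mem b a := by
    intro a
    by_cases ha : Univ.mem a F
    · obtain ⟨_, _, b, _, hb⟩ := hne t₁ (Cond.le_refl _) a (hF.of_mem ha) ha
      exact ⟨b, fun _ => hb⟩
    · exact ⟨a, fun h => (ha h).elim⟩
  choose f hf using hne'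
  have hmem : ∀ z, Univ.mem z (Univ.ofSet (f '' {a | Univ.mem a F})) ↔
      ∃ a, Univ.mem a F ∧ f a = z := fun z => by
    rw [Univ.mem_ofSet]; rfl
  refine ⟨t₁, Cond.le_refl _, Univ.ofSet (f '' {a | Univ.mem a F}), avail_iff.2 fun z hz => ?_,
    fun t₂ h₂ a _ ha => ⟨t₂, Cond.le_refl _, f a, ((hF.mono h₂).of_mem ha).of_mem (hf a ha),
      ⟨hf a ha, (hmem _).2 ⟨a, ha, rfl⟩⟩, ?_⟩⟩
  · obtain ⟨a, ha, rfl⟩ := (hmem z).1 hz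
    exact (hF.of_mem ha).of_mem (hf a ha)
  · rintro _ _ z _ ⟨hza, hz⟩
    obtain ⟨b, hb, rfl⟩ := (hmem z).1 hz
    rw [hdisj t₁ (Cond.le_refl _) a (hF.of_mem ha) t₁ (Cond.le_refl _) b (hF.of_mem hb) ha hb
      ⟨t₁, Cond.le_refl _, f b, (hF.of_mem ha).of_mem hza, hza, hf b hb⟩]

end Axioms

theorem exists_forall_notMem {α β : Type} (f : α → Finset β) (hα : Cardinal.aleph0 ≤ Cardinal.mk α)
    (h : Cardinal.mk α < Cardinal.mk β) : ∃ b, ∀ a, b ∉ f a := by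
  by_contra! hno
  have huniv : (⋃ a, (f a : Set β)) = Set.univ :=
    Set.eq_univ_of_forall fun b => Set.mem_iUnion.2 (hno b)
  refine h.not_ge ?_
  rw [← Cardinal.mk_univ, ← huniv]
  refine (Cardinal.mk_iUnion_le_sum_mk).trans
    ((Cardinal.sum_le_sum _ (fun _ => Cardinal.aleph0) fun a => ?_).trans ?_)
  · exact Cardinal.mk_le_aleph0
  · rw [Cardinal.sum_const', Cardinal.mul_aleph0_eq hα]

/-- A finite-set-valued function on pairs of indices does not meet every triple. -/
theorem exists_free_triple (S : Idx → Idx → Finset Idx) :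
    ∃ i j k, i ≠ j ∧ i ≠ k ∧ j ≠ k ∧ k ∉ S i j ∧ j ∉ S i k ∧ i ∉ S j k := by
  have h₁ : Cardinal.mk (ℕ × Set ℕ) = Cardinal.continuum := by
    simp
  have h₂ : Cardinal.aleph0 < Cardinal.mk (Set ℕ) := by
    simpa using Cardinal.aleph0_lt_continuum
  obtain ⟨c, hc⟩ := exists_forall_notMem (β := Set (Set ℕ))
    (fun a : ℕ × Set ℕ => (S (.inl a.1) (.inr (.inl a.2))).preimage (fun c => .inr (.inr c))
      (fun _ _ _ _ h => by simpa using h))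
    (by rw [h₁]; exact Cardinal.aleph0_le_continuum)
    (by
      rw [h₁, Cardinal.mk_set, Cardinal.mk_set, Cardinal.mk_nat, Cardinal.two_power_aleph0]
      exact Cardinal.cantor _)
  obtain ⟨b, hb⟩ := exists_forall_notMem (β := Set ℕ)
    (fun a : ℕ => (S (.inl a) (.inr (.inr c))).preimage (fun b => .inr (.inl b))
      (fun _ _ _ _ h => by simpa using h))
    (by simp) (by simpa using h₂)
  obtain ⟨a, ha⟩ := Infinite.exists_notMem_finset
    ((S (.inr (.inl b)) (.inr (.inr c))).preimage (fun a => .inl a)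
      (fun _ _ _ _ h => by simpa using h))
  refine ⟨.inl a, .inr (.inl b), .inr (.inr c), by simp, by simp, by simp, ?_, ?_, ?_⟩
  · exact fun h => hc (a, b) (Finset.mem_preimage.2 h)
  · exact fun h => hb a (Finset.mem_preimage.2 h)
  · exact fun h => ha (Finset.mem_preimage.2 h)

section Config

/-- The interpretation of `Fm.atomOver` at a stage. -/
def AtomOverAt (t : Cond) (i p : Univ) : Prop := p ≠ i ∧ Univ.mem p p ∧ Univ.mem i p ∧
  ∀ t', Cond.le t t' → ∀ z, Avail t' z → Univ.mem z p → z = p ∨ z = i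

/-- The interpretation of `Fm.linked` at a stage. -/
def LinkedAt (t : Cond) (p q k : Univ) : Prop := ∃ t', Cond.le t t' ∧ ∃ w, Avail t' w ∧
  Univ.mem w w ∧ Univ.mem p w ∧ Univ.mem q w ∧ Univ.mem k w

/-- The interpretation of `Fm.codes` at a stage. -/
def CodesAt (t : Cond) (e i j k : Univ) : Prop := Univ.mem k e ∧ ∃ t', Cond.le t t' ∧
  ∃ u, Avail t' u ∧ Univ.mem u e ∧ Univ.mem i u ∧ Univ.mem j u

variable {t : Cond} {v : ℕ → Univ}

theorem holds_atomOver {z i p : ℕ} (hi : i ≠ z) (hp : p ≠ z) :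
    Fm.Sat (Fm.relMem Univ.mem) Cond.le Avail (.atomOver z i p) t v ↔
      AtomOverAt t (v i) (v p) := by
  simp [Fm.atomOver, AtomOverAt, Function.update_of_ne hi, Function.update_of_ne hp]

theorem holds_linked {w p q k : ℕ} (hp : p ≠ w) (hq : q ≠ w) (hk : k ≠ w) :
    Fm.Sat (Fm.relMem Univ.mem) Cond.le Avail (.linked w p q k) t v ↔
      LinkedAt t (v p) (v q) (v k) := by
  simp [Fm.linked, LinkedAt, Function.update_of_ne hp, Function.update_of_ne hq,
    Function.update_of_ne hk]

theorem holds_codes {u e i j k : ℕ} (he : e ≠ u) (hi : i ≠ u) (hj : j ≠ u) :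
    Fm.Sat (Fm.relMem Univ.mem) Cond.le Avail (.codes u e i j k) t v ↔
      CodesAt t (v e) (v i) (v j) (v k) := by
  simp [Fm.codes, CodesAt, Function.update_of_ne he, Function.update_of_ne hi,
    Function.update_of_ne hj]

theorem CodesAt.codes {e i j k : Univ} (h : CodesAt t e i j k) : Codes Univ.mem e i j k := by
  obtain ⟨hk, _, _, u, _, hu⟩ := h
  exact ⟨hk, u, hu⟩

theorem codesAt_iff {e i j k : Univ} (he : Avail t e) :
    CodesAt t e i j k ↔ Codes Univ.mem e i j k :=
  ⟨CodesAt.codes, fun ⟨hk, u, hu, h⟩ => ⟨hk, t, Cond.le_refl t, u, he.of_mem hu, hu, h⟩⟩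

theorem atomOverAt_iff {i : Idx} {p : Univ} (hp : Avail t p) :
    AtomOverAt t (.base (.idx i)) p ↔ ∃ a, p = .base (.atom i a) := by
  constructor
  · rintro ⟨hne, hpp, hip, h⟩
    obtain ⟨b, rfl⟩ := Univ.mem_self hpp
    replace h : ∀ c ∈ b.ext, c = b ∨ c = .idx i := by
      intro c hc
      have hc := Univ.base_mem_base.2 hc
      simpa using h t (Cond.le_refl t) _ (hp.of_mem hc) hc
    rw [Univ.base_mem_base] at hip
    cases b with
    | idx j =>
      obtain rfl : i = j := by simpa [Base.ext] using hip
      exact (hne rfl).elim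
    | nat n => simp [Base.ext] at hip
    | atom j a =>
      obtain rfl : i = j := by simpa [Base.ext] using hip
      exact ⟨a, rfl⟩
    | link j a k b s =>
      rcases h (.atom j a) (.inr (.inl rfl)) with h | h <;> cases h
  · rintro ⟨a, rfl⟩
    refine ⟨by simp, by simp [Base.ext], by simp [Base.ext], fun _ _ z _ hz => ?_⟩
    obtain ⟨c, hc, rfl⟩ := Univ.mem_base.1 hz
    simpa [Base.ext] using hc

open Classical in
theorem linkedAt_iff {i j k : Idx} {p q : Shift} (hij : i ≠ j) (hi : i ∈ t.dom) (hj : j ∈ t.dom) :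
    LinkedAt t (.base (.atom i p)) (.base (.atom j q)) (.base (.idx k)) ↔
      k ≠ i ∧ k ≠ j ∧ p {i, j, k} + q {i, j, k} + t.fn i j k = 1 := by
  constructor
  · rintro ⟨t', ht, w, hw, hww, hpw, hqw, hkw⟩
    obtain ⟨b, rfl⟩ := Univ.mem_self hww
    rw [Univ.base_mem_base] at hpw hqw hkw
    have hb := hw.allowed
    cases b with
    | idx l => cases hpw
    | nat n => obtain ⟨m, _, h⟩ := hpw; cases h
    | atom l a =>
      have hp : i = l ∧ p = a := by simpa [Base.ext] using hpw
      have hq : j = l ∧ q = a := by simpa [Base.ext] using hqw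
      exact (hij (hp.1.trans hq.1.symm)).elim
    | link l a m b s =>
      obtain ⟨hl, hm, hlm, hs⟩ := hb
      have hks : k ∈ s := by simpa [Base.ext, -Sum.exists] using hkw
      obtain ⟨hkl, hkm, h⟩ := (hs k).1 hks
      have hp : (i = l ∧ p = a) ∨ (i = m ∧ p = b) := by simpa [Base.ext] using hpw
      have hq : (j = l ∧ q = a) ∨ (j = m ∧ q = b) := by simpa [Base.ext] using hqw
      rcases hp with ⟨rfl, rfl⟩ | ⟨rfl, rfl⟩ <;> rcases hq with ⟨rfl, rfl⟩ | ⟨rfl, rfl⟩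
      · exact (hij rfl).elim
      · rw [ht.2 i hi j hj k hij hkl hkm]
        exact ⟨hkl, hkm, h⟩
      · rw [ht.2 i hi j hj k hij hkm hkl, t'.symm, add_comm (p _), ← triple_swap]
        exact ⟨hkm, hkl, h⟩
      · exact (hij rfl).elim
  · intro hk
    have hfin : {k | k ≠ i ∧ k ≠ j ∧ p {i, j, k} + q {i, j, k} + t.fn i j k = 1}.Finite := by
      refine ((t.act (Function.update (fun _ => p) j q)).finite i j).subset fun l hl => ?_
      obtain ⟨-, -, hl⟩ := hl
      simp [Cond.act, Function.update_of_ne hij, add_comm (t.fn i j l), hl]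
    refine ⟨t, Cond.le_refl t, .base (.link i p j q hfin.toFinset),
      avail_base.2 ⟨hi, hj, hij, fun l => by simp⟩, ?_⟩
    simpa [Base.ext, -Sum.exists] using hk

end Config

section Config

/-- The set of all indices. -/
noncomputable def indices : Univ := Univ.ofSet (Set.range fun i => .base (.idx i))

/-- The set of indices corresponding to a finite set. -/
noncomputable def indexSet (s : Finset Idx) : Univ :=
  Univ.ofSet (Set.range fun i : s => .base (.idx i.1))

/-- The set of all finite sets of indices. -/
noncomputable def finiteIndexSets : Univ := Univ.ofSet (Set.range indexSet)

/-- The set `{{i, j}, k}`. -/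
noncomputable def tripleCode (i j k : Idx) : Univ :=
  Univ.ofSet {Univ.ofSet {.base (.idx i), .base (.idx j)}, .base (.idx k)}

/-- The set of all `{{i, j}, k}` for distinct indices `i` and `j`. -/
noncomputable def tripleCodes : Univ :=
  Univ.ofSet (Set.range fun a : {a : Idx × Idx × Idx // a.1 ≠ a.2.1} =>
    tripleCode a.1.1 a.1.2.1 a.1.2.2)

theorem mem_indices {x : Univ} : Univ.mem x indices ↔ ∃ i, x = .base (.idx i) := by
  simp [indices, eq_comm, -Sum.exists]

theorem mem_indexSet {s : Finset Idx} {x : Univ} :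
    Univ.mem x (indexSet s) ↔ ∃ i ∈ s, x = .base (.idx i) := by
  simp [indexSet, eq_comm, -Sum.exists]

theorem mem_finiteIndexSets {x : Univ} : Univ.mem x finiteIndexSets ↔ ∃ s, x = indexSet s := by
  simp [finiteIndexSets, eq_comm]

theorem mem_tripleCode {i j k : Idx} {x : Univ} : Univ.mem x (tripleCode i j k) ↔
    x = Univ.ofSet {.base (.idx i), .base (.idx j)} ∨ x = .base (.idx k) := by
  simp [tripleCode]

theorem mem_tripleCodes {x : Univ} :
    Univ.mem x tripleCodes ↔ ∃ i j k, i ≠ j ∧ x = tripleCode i j k := by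
  rw [tripleCodes, Univ.mem_ofSet]
  constructor
  · rintro ⟨⟨⟨i, j, k⟩, h⟩, rfl⟩
    exact ⟨i, j, k, h, rfl⟩
  · rintro ⟨i, j, k, h, rfl⟩
    exact ⟨⟨⟨i, j, k⟩, h⟩, rfl⟩

theorem avail_idx (t : Cond) (i : Idx) : Avail t (.base (.idx i)) := avail_base.2 trivial

theorem avail_indices (t : Cond) : Avail t indices := avail_iff.2 fun x hx => by
  obtain ⟨i, rfl⟩ := mem_indices.1 hx
  exact avail_idx t i

theorem avail_indexSet (t : Cond) (s : Finset Idx) : Avail t (indexSet s) :=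
  avail_iff.2 fun x hx => by
    obtain ⟨i, -, rfl⟩ := mem_indexSet.1 hx
    exact avail_idx t i

theorem avail_finiteIndexSets (t : Cond) : Avail t finiteIndexSets := avail_iff.2 fun x hx => by
  obtain ⟨s, rfl⟩ := mem_finiteIndexSets.1 hx
  exact avail_indexSet t s

theorem avail_tripleCode (t : Cond) (i j k : Idx) : Avail t (tripleCode i j k) :=
  avail_iff.2 fun x hx => by
    rcases mem_tripleCode.1 hx with rfl | rfl
    · refine avail_iff.2 fun y hy => ?_
      rcases (Univ.mem_ofSet _ _).1 hy with rfl | rfl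
      exacts [avail_idx t i, avail_idx t j]
    · exact avail_idx t k

theorem avail_tripleCodes (t : Cond) : Avail t tripleCodes := avail_iff.2 fun x hx => by
  obtain ⟨i, j, k, -, rfl⟩ := mem_tripleCodes.1 hx
  exact avail_tripleCode t i j k

theorem codes_tripleCode (i j k : Idx) :
    Codes Univ.mem (tripleCode i j k) (.base (.idx i)) (.base (.idx j)) (.base (.idx k)) :=
  ⟨mem_tripleCode.2 (.inr rfl), _, mem_tripleCode.2 (.inl rfl), by simp, by simp⟩

theorem eq_of_codes_tripleCode {i j k a b c : Idx} (hij : i ≠ j) (hab : a ≠ b)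
    (h : Codes Univ.mem (tripleCode i j k) (.base (.idx a)) (.base (.idx b)) (.base (.idx c))) :
    c = k ∧ ((a = i ∧ b = j) ∨ (a = j ∧ b = i)) := by
  obtain ⟨hc, u, hu, ha, hb⟩ := h
  constructor
  · rcases mem_tripleCode.1 hc with hc | hc
    · have hi : Univ.mem (.base (.idx i)) (.base (.idx c)) := by simp [hc]
      have hj : Univ.mem (.base (.idx j)) (.base (.idx c)) := by simp [hc]
      simp only [Univ.base_mem_base, Base.ext, Set.mem_singleton_iff, Base.idx.injEq] at hi hj
      exact (hij (hi.trans hj.symm)).elim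
    · simpa using hc
  · rcases mem_tripleCode.1 hu with rfl | rfl
    · simp only [Univ.mem_ofSet, Set.mem_insert_iff, Set.mem_singleton_iff, Univ.base_inj,
        Base.idx.injEq] at ha hb
      rcases ha with rfl | rfl <;> rcases hb with rfl | rfl
      · exact (hab rfl).elim
      · exact .inl ⟨rfl, rfl⟩
      · exact .inr ⟨rfl, rfl⟩
      · exact (hab rfl).elim
    · simp only [Univ.base_mem_base, Base.ext, Set.mem_singleton_iff, Base.idx.injEq] at ha hb
      exact (hab (ha.trans hb.symm)).elim

theorem holds_config {t : Cond} {v : ℕ → Univ} : Holds .config t v := by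
  classical
  simp only [Holds, Fm.config, Fm.configAtoms, Fm.configBound, Fm.configLinked, Fm.configFree,
    Fm.configCode, Fm.configUnique, Fm.allIn, Fm.exIn, Fm.ne, Fm.atomSet, Fm.sat_ex, Fm.sat_and,
    Fm.sat_imp, Fm.sat_neg, Fm.sat_or, Fm.sat_iff, Fm.sat_rel, Fm.sat_all]
  simp (disch := decide) only [holds_atomOver, holds_linked, holds_codes, Fm.relMem_zero,
    Fm.relMem_one, Function.update_self, Function.update_of_ne]
  refine ⟨t, Cond.le_refl t, indices, avail_indices t, t, Cond.le_refl t, tripleCodes,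
    avail_tripleCodes t, t, Cond.le_refl t, finiteIndexSets, avail_finiteIndexSets t,
    ?_, ?_, ?_, ?_, ?_, ?_⟩
  · intro t₁ _ x _ hx
    obtain ⟨i, rfl⟩ := mem_indices.1 hx
    obtain ⟨t₂, h₂, hi⟩ := Cond.exists_le t₁ {i}
    have hmem : ∀ z, Univ.mem z (Univ.ofSet (Set.range fun p => Univ.base (.atom i p))) ↔
        ∃ p, z = .base (.atom i p) := fun z => by simp [eq_comm]
    have hav : ∀ p, Avail t₂ (.base (.atom i p)) := fun p =>
      avail_base.2 (Finset.singleton_subset_iff.1 hi)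
    refine ⟨t₂, h₂, Univ.ofSet (Set.range fun p => Univ.base (.atom i p)),
      avail_iff.2 fun z hz => ?_, ⟨t₂, Cond.le_refl _, _, hav 0, (hmem _).2 ⟨0, rfl⟩⟩,
      fun t₃ _ p hp => (hmem p).trans (atomOverAt_iff hp).symm⟩
    obtain ⟨p, rfl⟩ := (hmem z).1 hz
    exact hav p
  · intro t₁ _ x _ hx t₂ _ y _ hy hxy t₃ h₃ p hp t₄ h₄ q hq hip hjq
    obtain ⟨i, rfl⟩ := mem_indices.1 hx
    obtain ⟨j, rfl⟩ := mem_indices.1 hy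
    have hij : i ≠ j := by simpa using hxy
    obtain ⟨p, rfl⟩ := (atomOverAt_iff (hp.mono h₄)).1 hip
    obtain ⟨q, rfl⟩ := (atomOverAt_iff hq).1 hjq
    have hi : i ∈ t₄.dom := (hp.mono h₄).allowed
    have hj : j ∈ t₄.dom := hq.allowed
    refine ⟨t₄, Cond.le_refl _,
      indexSet ((t₄.act (Function.update (fun _ => p) j q)).finite i j).toFinset,
      avail_indexSet _ _, mem_finiteIndexSets.2 ⟨_, rfl⟩, fun t₅ h₅ z _ hz hl => ?_⟩
    obtain ⟨k, rfl⟩ := mem_indices.1 hz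
    obtain ⟨hki, hkj, h⟩ := (linkedAt_iff hij (h₅.1 hi) (h₅.1 hj)).1 hl
    rw [← h₅.2 i hi j hj k hij hki hkj, add_comm] at h
    refine mem_indexSet.2 ⟨k, ?_, rfl⟩
    simp [Cond.act, Function.update_of_ne hij, h]
  · intro t₁ _ x _ hx t₂ _ y _ hy t₃ _ z _ hz hxy hxz hyz t₄ h₄ p hp t₅ h₅ q hq t₆ h₆ r hr
      hip hjq hkr
    obtain ⟨i, rfl⟩ := mem_indices.1 hx
    obtain ⟨j, rfl⟩ := mem_indices.1 hy
    obtain ⟨k, rfl⟩ := mem_indices.1 hz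
    have hij : i ≠ j := by simpa using hxy
    have hik : i ≠ k := by simpa using hxz
    have hjk : j ≠ k := by simpa using hyz
    replace hp := hp.mono (Cond.le_trans h₅ h₆)
    replace hq := hq.mono h₆
    obtain ⟨p, rfl⟩ := (atomOverAt_iff hp).1 hip
    obtain ⟨q, rfl⟩ := (atomOverAt_iff hq).1 hjq
    obtain ⟨r, rfl⟩ := (atomOverAt_iff hr).1 hkr
    have hi : i ∈ t₆.dom := hp.allowed
    have hj : j ∈ t₆.dom := hq.allowed
    have hk : k ∈ t₆.dom := hr.allowed
    rw [linkedAt_iff hij hi hj, linkedAt_iff hik hi hk, linkedAt_iff hjk hj hk,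
      triple_rotate i j k, triple_rotate' i j k]
    have h := t₆.odd i hi j hj k hk hij hik hjk
    have key : ∀ a b c d e f : ZMod 2, d + e + f = 1 →
        a + b + d = 1 ∨ a + c + e = 1 ∨ b + c + f = 1 := by decide
    rcases key (p {i, j, k}) (q {i, j, k}) (r {i, j, k}) _ _ _ h with h | h | h
    · exact .inl ⟨hik.symm, hjk.symm, h⟩
    · exact .inr (.inl ⟨hij.symm, hjk, h⟩)
    · exact .inr (.inr ⟨hij, hik, h⟩)
  · intro t₁ _ g hg h
    have key : ∀ i j, ∃ s : Finset Idx, i ≠ j → ∀ k e, Univ.mem e g →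
        Codes Univ.mem e (.base (.idx i)) (.base (.idx j)) (.base (.idx k)) → k ∈ s := by
      intro i j
      by_cases hij : i = j
      · exact ⟨∅, fun h => (h hij).elim⟩
      obtain ⟨t₂, h₂, x, _, hx, hs⟩ := h t₁ (Cond.le_refl _) (.base (.idx i)) (avail_idx _ _)
        (mem_indices.2 ⟨i, rfl⟩) t₁ (Cond.le_refl _) (.base (.idx j)) (avail_idx _ _)
        (mem_indices.2 ⟨j, rfl⟩) (by simpa using hij)
      obtain ⟨s, rfl⟩ := mem_finiteIndexSets.1 hx
      refine ⟨s, fun _ k e he hc => ?_⟩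
      have hav := (hg.of_mem he).mono h₂
      obtain ⟨l, hl, hkl⟩ := mem_indexSet.1 (hs t₂ (Cond.le_refl _) (.base (.idx k))
        (avail_idx _ _) (mem_indices.2 ⟨k, rfl⟩) t₂ (Cond.le_refl _) e hav he
        ((codesAt_iff hav).2 hc))
      obtain rfl : k = l := by simpa using hkl
      exact hl
    choose S hS using key
    obtain ⟨i, j, k, hij, hik, hjk, h₁, h₂, h₃⟩ := exists_free_triple S
    refine ⟨t₁, Cond.le_refl _, .base (.idx i), avail_idx _ _, mem_indices.2 ⟨i, rfl⟩,
      t₁, Cond.le_refl _, .base (.idx j), avail_idx _ _, mem_indices.2 ⟨j, rfl⟩,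
      t₁, Cond.le_refl _, .base (.idx k), avail_idx _ _, mem_indices.2 ⟨k, rfl⟩,
      by simpa using hij, by simpa using hik, by simpa using hjk, fun t₂ _ e _ he =>
      ⟨fun hc => ?_, fun hc => ?_, fun hc => ?_⟩⟩
    · exact h₁ (hS i j hij k e he hc.codes)
    · exact h₂ (hS i k hik j e he hc.codes)
    · exact h₃ (hS j k hjk i e he hc.codes)
  · intro t₁ _ x _ hx t₂ _ y _ hy t₃ _ z _ hz hxy _ _
    obtain ⟨i, rfl⟩ := mem_indices.1 hx
    obtain ⟨j, rfl⟩ := mem_indices.1 hy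
    obtain ⟨k, rfl⟩ := mem_indices.1 hz
    have hij : i ≠ j := by simpa using hxy
    exact ⟨t₃, Cond.le_refl _, tripleCode i j k, avail_tripleCode _ _ _ _,
      mem_tripleCodes.2 ⟨i, j, k, hij, rfl⟩,
      (codesAt_iff (avail_tripleCode _ _ _ _)).2 (codes_tripleCode i j k)⟩
  · intro t₁ _ e _ he t₂ _ x _ hx t₃ _ y _ hy t₄ _ z _ hz t₅ _ x' _ hx' t₆ _ y' _ hy' t₇ _ z' _ hz'
      hxy hxy' hc hc'
    obtain ⟨i, j, k, hij, rfl⟩ := mem_tripleCodes.1 he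
    obtain ⟨a, rfl⟩ := mem_indices.1 hx
    obtain ⟨b, rfl⟩ := mem_indices.1 hy
    obtain ⟨c, rfl⟩ := mem_indices.1 hz
    obtain ⟨a', rfl⟩ := mem_indices.1 hx'
    obtain ⟨b', rfl⟩ := mem_indices.1 hy'
    obtain ⟨c', rfl⟩ := mem_indices.1 hz'
    obtain ⟨rfl, h⟩ := eq_of_codes_tripleCode hij (by simpa using hxy) hc.codes
    obtain ⟨rfl, h'⟩ := eq_of_codes_tripleCode hij (by simpa using hxy') hc'.codes
    refine ⟨rfl, ?_⟩
    rcases h with ⟨rfl, rfl⟩ | ⟨rfl, rfl⟩ <;> rcases h' with ⟨rfl, rfl⟩ | ⟨rfl, rfl⟩ <;> simp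

end Config

instance : Nonempty Cond :=
  ⟨⟨∅, fun _ _ _ => 0, fun _ _ _ => rfl, fun _ _ => by simp,
    fun _ h => (Finset.notMem_empty _ h).elim⟩⟩

theorem exists_zc_config : ∃ (M : Type) (mem : M → M → Prop), ZC M mem ∧
    ∃ x, Fm.config.Tru (Fm.relMem mem) (fun _ => x) := by
  obtain ⟨M, mem, hC, x, hx⟩ := exists_model (Classical.arbitrary Cond)
  exact ⟨M, mem, ⟨Fm.tru_axExt.1 (hx _ holds_axExt), Fm.tru_axPairing.1 (hx _ holds_axPairing),
    Fm.tru_axUnion.1 (hx _ holds_axUnion), Fm.tru_axPower.1 (hx _ holds_axPower),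
    Fm.tru_axInfinity.1 (hx _ holds_axInfinity), hC, Fm.tru_axChoice.1 (hx _ holds_axChoice)⟩,
    x, hx _ holds_config⟩

/-- **Global Choice is not conservative over ZC.**  There is a sentence `φ` of the
language `{∈}` such that every model `(M, mem, j)` of ZC + GC (ZC together with the
Global Choice axiom and Comprehension for `{∈, j}`-formulas) satisfies `φ`, while
`φ` is not a logical consequence of ZC: some model of ZC fails to satisfy `φ`. -/
theorem globalChoice_not_conservative_over_ZC :
    ∃ φ : Lmem.Sentence,
      (∀ (M : Type) (mem : M → M → Prop) (j : M → M),
          ZC M mem → AxGC M mem j → AxCompJ M mem j →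
          (letI := memStructure mem; M ⊨ φ)) ∧
      ¬ (∀ (M : Type) (mem : M → M → Prop),
          ZC M mem → (letI := memStructure mem; M ⊨ φ)) := by
  refine ⟨Fm.config.neg.toSentence, fun M mem j hZ hj hC => ?_, fun h => ?_⟩
  · refine (Fm.realize_toSentence mem _).2 fun x hx => ?_
    obtain ⟨I, Tr, F, hIF⟩ := (Fm.tru_config (fun _ _ => Iff.rfl) _).1 hx
    exact not_config_of_axGC hZ.1 hj hC I Tr F hIF
  · obtain ⟨M, mem, hZ, x, hx⟩ := exists_zc_config
    exact (Fm.realize_toSentence mem _).1 (h M mem hZ) x hx
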